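/- arXiv:0806.4329 — 5 statements merged into one kernel-verified Lean document; each statement's English description precedes it below -/
import Mathlib

section
/- Let d ∈ ℕ, 2 ≤ q ≤ p' ≤ ∞, and let μ be a positive finite Borel measure on ℝ whose associated quantity Q_{p,q} (formed with the one-dimensional heat kernel) is strictly decreasing on an interval (0,t₀). Then the d-fold product measure μ^{⊗d} on ℝ^d is a positive finite Borel measure whose associated quantity Q_{p,q} (formed with the d-dimensional heat kernel) is strictly decreasing on (0,t₀). -/
open MeasureTheory Real Filter
open scoped FourierTransform ENNReal Topology

/-- The heat kernel `H_t(x) = t^{-d/2} e^{-π|x|²/t}` on `ℝ^d`. -/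
noncomputable def heatKernel (d : ℕ) (t : ℝ) (x : EuclideanSpace ℝ (Fin d)) : ℝ :=
  t ^ (-(d : ℝ) / 2) * Real.exp (-π * ‖x‖ ^ 2 / t)

/-- The solution `u(t,·) = H_t ∗ μ` of the heat equation with initial datum `μ`. -/
noncomputable def heatEvolution (d : ℕ) (μ : Measure (EuclideanSpace ℝ (Fin d)))
    (t : ℝ) (x : EuclideanSpace ℝ (Fin d)) : ℝ :=
  ∫ y, heatKernel d t (x - y) ∂μ

/-- `Q_{p,q}(t) = t^{(d/2)(1/q - 1/p')} ‖(u(t,·)^{1/p})^∧‖_{L^q(ℝ^d)}`, where `1/p' = 1 - 1/p`. -/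
noncomputable def Q (d : ℕ) (μ : Measure (EuclideanSpace ℝ (Fin d))) (p q t : ℝ) : ℝ :=
  t ^ ((d : ℝ) / 2 * (1 / q - (1 - 1 / p))) *
    (eLpNorm (𝓕 fun x => ((heatEvolution d μ t x ^ (1 / p) : ℝ) : ℂ))
      (ENNReal.ofReal q) volume).toReal

/-- The one-dimensional heat kernel `H_t(x) = t^{-1/2} e^{-πx²/t}` on `ℝ`. -/
noncomputable def heatKernel1 (t x : ℝ) : ℝ :=
  t ^ (-(1 : ℝ) / 2) * Real.exp (-π * x ^ 2 / t)

/-- The one-dimensional quantity `Q_{p,q}(t)` associated to a measure `μ` on `ℝ`. -/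
noncomputable def Q1dim (μ : Measure ℝ) (p q t : ℝ) : ℝ :=
  t ^ ((1 : ℝ) / 2 * (1 / q - (1 - 1 / p))) *
    (eLpNorm (𝓕 fun x => (((∫ y, heatKernel1 t (x - y) ∂μ) ^ (1 / p) : ℝ) : ℂ))
      (ENNReal.ofReal q) volume).toReal

/-- The `d`-fold tensor power `μ^{⊗d}` of a measure on `ℝ`, as a measure on `ℝ^d`. -/
noncomputable def tensorPower (d : ℕ) (μ : Measure ℝ) : Measure (EuclideanSpace ℝ (Fin d)) :=
  (Measure.pi fun _ : Fin d => μ).map (MeasurableEquiv.toLp 2 (Fin d → ℝ))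

/-- Tonelli's theorem for a product of functions of one coordinate each. -/
theorem lintegral_fin_prod_eq_pow {E : Type*} [MeasurableSpace E] (μ : Measure E) [SigmaFinite μ]
    {f : E → ℝ≥0∞} (hf : Measurable f) (n : ℕ) :
    ∫⁻ x : Fin n → E, ∏ i, f (x i) ∂(Measure.pi fun _ => μ) = (∫⁻ x, f x ∂μ) ^ n := by
  induction n with
  | zero => simp
  | succ n ih =>
    have hmp := (measurePreserving_piFinSuccAbove (fun _ : Fin (n + 1) => μ) 0).symm
    rw [← hmp.lintegral_comp_emb (MeasurableEquiv.measurableEmbedding _)]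
    simp_rw [MeasurableEquiv.piFinSuccAbove_symm_apply, Fin.prod_univ_succ, Fin.insertNthEquiv,
      Equiv.coe_fn_mk, Fin.insertNth_zero, Fin.cons_zero, Fin.cons_succ, cast_eq]
    rw [lintegral_prod_mul (g := fun y : Fin n → E => ∏ i, f (y i)) hf.aemeasurable
      (Finset.measurable_prod _ fun i _ => hf.comp (measurable_pi_apply i)).aemeasurable, ih,
      pow_succ']

theorem measurable_fourier (f : ℝ → ℂ) : Measurable (𝓕 f) := by
  by_cases hf : Integrable f
  · exact (VectorFourier.fourierIntegral_continuous Real.continuous_fourierChar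
      (by fun_prop) hf : Continuous (𝓕 f)).measurable
  · have : 𝓕 f = fun _ => 0 := by
      ext w
      rw [Real.fourier_eq]
      apply integral_undef
      rwa [Real.fourierIntegral_convergent_iff]
    rw [this]
    exact measurable_const

theorem fourier_fin_prod (d : ℕ) (f : ℝ → ℂ) (w : EuclideanSpace ℝ (Fin d)) :
    𝓕 (fun x : EuclideanSpace ℝ (Fin d) => ∏ i, f (x i)) w = ∏ i, 𝓕 f (w i) := by
  simp_rw [Real.fourier_eq]
  rw [← integral_fintype_prod_volume_eq_prod,
    ← (PiLp.volume_preserving_toLp (Fin d)).integral_comp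
      (MeasurableEquiv.toLp 2 (Fin d → ℝ)).measurableEmbedding]
  congr 1 with x
  simp [PiLp.inner_apply, Circle.smul_def, Finset.prod_mul_distrib, Real.fourierChar_apply,
    ← Complex.exp_sum, Finset.mul_sum, Finset.sum_mul]

theorem eLpNorm_fin_prod (d : ℕ) {f : ℝ → ℂ} (hf : Measurable f) {q : ℝ} (hq : 0 < q) :
    eLpNorm (fun x : EuclideanSpace ℝ (Fin d) => ∏ i, f (x i)) (ENNReal.ofReal q) volume =
      eLpNorm f (ENNReal.ofReal q) volume ^ d := by
  have h0 : ENNReal.ofReal q ≠ 0 := by simpa using hq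
  rw [eLpNorm_eq_lintegral_rpow_enorm_toReal h0 ENNReal.ofReal_ne_top,
    eLpNorm_eq_lintegral_rpow_enorm_toReal h0 ENNReal.ofReal_ne_top, ENNReal.toReal_ofReal hq.le,
    ← (PiLp.volume_preserving_toLp (Fin d)).lintegral_comp_emb
      (MeasurableEquiv.toLp 2 (Fin d → ℝ)).measurableEmbedding,
    ← ENNReal.rpow_natCast, ← ENNReal.rpow_mul, mul_comm, ENNReal.rpow_mul, ENNReal.rpow_natCast,
    ← lintegral_fin_prod_eq_pow volume (hf.enorm.pow_const q), volume_pi]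
  simp_rw [ENNReal.prod_rpow_of_nonneg hq.le, enorm_eq_nnnorm, nnnorm_prod,
    ENNReal.ofNNReal_finsetProd]

theorem heatKernel_eq_prod (d : ℕ) {t : ℝ} (ht : 0 < t) (x : EuclideanSpace ℝ (Fin d)) :
    heatKernel d t x = ∏ i, heatKernel1 t (x i) := by
  simp only [heatKernel, heatKernel1, Finset.prod_mul_distrib, Finset.prod_const,
    Finset.card_univ, Fintype.card_fin, ← Real.exp_sum, EuclideanSpace.real_norm_sq_eq,
    Finset.mul_sum, Finset.sum_div]
  rw [← Real.rpow_natCast, ← Real.rpow_mul ht.le]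
  congr 2
  ring

theorem heatKernel1_nonneg {t : ℝ} (ht : 0 < t) (x : ℝ) : 0 ≤ heatKernel1 t x := by
  unfold heatKernel1
  positivity

theorem heatEvolution_tensorPower (d : ℕ) (μ : Measure ℝ) [IsFiniteMeasure μ] {t : ℝ}
    (ht : 0 < t) (x : EuclideanSpace ℝ (Fin d)) :
    heatEvolution d (tensorPower d μ) t x = ∏ i, ∫ y, heatKernel1 t (x i - y) ∂μ := by
  rw [heatEvolution, tensorPower, integral_map_equiv, ← integral_fintype_prod_eq_prod]
  simp [heatKernel_eq_prod d ht]

theorem Q_tensorPower (d : ℕ) (μ : Measure ℝ) [IsFiniteMeasure μ] (p : ℝ) {q t : ℝ}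
    (hq : 0 < q) (ht : 0 < t) : Q d (tensorPower d μ) p q t = Q1dim μ p q t ^ d := by
  have hfun (x : EuclideanSpace ℝ (Fin d)) :
      ((heatEvolution d (tensorPower d μ) t x ^ (1 / p) : ℝ) : ℂ) =
        ∏ i, (((∫ y, heatKernel1 t (x i - y) ∂μ) ^ (1 / p) : ℝ) : ℂ) := by
    rw [heatEvolution_tensorPower d μ ht, ← Real.finsetProd_rpow _ _
      fun i _ => integral_nonneg fun y => heatKernel1_nonneg ht _, Complex.ofReal_prod]
  simp_rw [Q, Q1dim, hfun]
  rw [funext (fourier_fin_prod d fun x => (((∫ y, heatKernel1 t (x - y) ∂μ) ^ (1 / p) : ℝ) : ℂ)),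
    eLpNorm_fin_prod d (measurable_fourier _) hq, ENNReal.toReal_pow, mul_pow,
    ← Real.rpow_natCast (t ^ _), ← Real.rpow_mul ht.le]
  congr 2
  ring

/-- if `μ` is a positive finite Borel measure on `ℝ` whose associated `Q_{p,q}` is
strictly decreasing on `(0,t₀)`, then `μ^{⊗d}` is a positive finite Borel measure on `ℝ^d` whose
associated `Q_{p,q}` is strictly decreasing on `(0,t₀)`. -/
theorem statement2 (d : ℕ) (hd : 0 < d) (p q : ℝ) (hp : 1 ≤ p) (hq : 2 ≤ q)
    (hqp : 1 - 1 / p ≤ 1 / q) (μ : Measure ℝ) [IsFiniteMeasure μ] (hμ : μ ≠ 0)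
    (t₀ : ℝ) (ht₀ : 0 < t₀) (hmono : StrictAntiOn (Q1dim μ p q) (Set.Ioo 0 t₀)) :
    tensorPower d μ ≠ 0 ∧ IsFiniteMeasure (tensorPower d μ) ∧
      StrictAntiOn (Q d (tensorPower d μ) p q) (Set.Ioo 0 t₀) := by
  have hfin : IsFiniteMeasure (tensorPower d μ) := by
    unfold tensorPower
    infer_instance
  refine ⟨?_, hfin, fun a ha b hb hab => ?_⟩
  · rw [Ne, ← Measure.measure_univ_eq_zero, tensorPower, MeasurableEquiv.map_apply]
    simp [Measure.pi_univ, hμ]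
  · rw [Q_tensorPower d μ p (by linarith) ha.1, Q_tensorPower d μ p (by linarith) hb.1]
    refine pow_lt_pow_left₀ (hmono ha hb hab) ?_ hd.ne'
    exact mul_nonneg (Real.rpow_nonneg hb.1.le _) ENNReal.toReal_nonneg
end

section
/- Let q > 2 and let μ be a finite sum of Dirac delta measures on ℝ, each supported at an integer, and let c_n = ∫₀¹ |μ̂(ξ)|^q e^{−2πinξ} dξ. Then the function t ↦ Q_{1,q}(t)^q is differentiable on (0,∞) and its derivative is (d/dt)[Q_{1,q}(t)^q] = (π/q^{3/2}) t^{−2} Σ_{n ∈ ℤ, n ≠ 0} n² c_n e^{−πn²/(qt)} = (π/q^{3/2}) t^{−2} e^{−π/(qt)} ( c₁ + c₋₁ + Σ_{n≥2} n²(c_n + c_{−n}) e^{−π(n²−1)/(qt)} ). -/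
open MeasureTheory Real Filter
open scoped FourierTransform ENNReal Topology

/-- The Fourier transform `μ̂(ξ) = ∫ e^{-2πi x ξ} dμ(x)` of a finite Borel measure on `ℝ`. -/
noncomputable def fourierMeasure (μ : Measure ℝ) (ξ : ℝ) : ℂ :=
  ∫ x, Complex.exp (((-2) * π * x * ξ : ℝ) * Complex.I) ∂μ

/-- The `n`-th Fourier coefficient `c_n = ∫₀¹ |μ̂(ξ)|^q e^{-2πinξ} dξ` of `|μ̂|^q`. -/
noncomputable def cCoeff (μ : Measure ℝ) (q : ℝ) (n : ℤ) : ℂ :=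
  ∫ ξ in (0 : ℝ)..1,
    ((‖fourierMeasure μ ξ‖ ^ q : ℝ) : ℂ) *
      Complex.exp (((-2) * π * n * ξ : ℝ) * Complex.I)

/-- `Q_{1,q}(t) = t^{1/(2q)} ‖(H_t ∗ μ)^∧‖_{L^q(ℝ)}`. -/
noncomputable def Q1 (μ : Measure ℝ) (q t : ℝ) : ℝ :=
  t ^ (1 / (2 * q)) *
    (eLpNorm (𝓕 fun x => (((∫ y, heatKernel1 t (x - y) ∂μ) : ℝ) : ℂ))
      (ENNReal.ofReal q) volume).toReal


lemma fourier_heat_term {t : ℝ} (ht : 0 < t) (a ξ : ℝ) :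
    Integrable (fun x : ℝ => Complex.exp (((-2) * π * x * ξ : ℝ) * Complex.I) *
      (heatKernel1 t (x - a) : ℂ)) ∧
    ∫ x : ℝ, Complex.exp (((-2) * π * x * ξ : ℝ) * Complex.I) * (heatKernel1 t (x - a) : ℂ) =
      (Real.exp (-π * t * ξ ^ 2) : ℂ) *
        Complex.exp (((-2) * π * a * ξ : ℝ) * Complex.I) := by
  have hπ : (π : ℂ) ≠ 0 := by exact_mod_cast pi_ne_zero
  have ht' : (t : ℂ) ≠ 0 := by exact_mod_cast ht.ne'
  have key : (fun x : ℝ => Complex.exp (((-2) * π * x * ξ : ℝ) * Complex.I) *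
      (heatKernel1 t (x - a) : ℂ)) = fun x : ℝ => ((t ^ (-(1 : ℝ) / 2) : ℝ) : ℂ) *
      Complex.exp (((-π / t : ℝ) : ℂ) * x ^ 2 +
        (2 * π * a / t - 2 * π * ξ * Complex.I) * x + (-π * a ^ 2 / t)) := by
    funext x
    rw [heatKernel1, Complex.ofReal_mul (t ^ _), mul_left_comm, Complex.ofReal_exp, ← Complex.exp_add]
    congr 2
    push_cast
    field_simp
    ring
  have hb : (((-π / t : ℝ) : ℂ)).re < 0 := by
    rw [Complex.ofReal_re, neg_div]
    exact neg_lt_zero.2 (by positivity)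
  rw [key]
  refine ⟨(integrable_cexp_quadratic' hb _ _).const_mul _, ?_⟩
  rw [integral_const_mul, integral_cexp_quadratic hb, ← mul_assoc]
  have h1 : ((t ^ (-(1 : ℝ) / 2) : ℝ) : ℂ) *
      ((π : ℂ) / -((-π / t : ℝ) : ℂ)) ^ (1 / 2 : ℂ) = 1 := by
    have : (π : ℂ) / -((-π / t : ℝ) : ℂ) = (t : ℂ) := by
      push_cast; field_simp
    rw [this, show (1 / 2 : ℂ) = ((1 / 2 : ℝ) : ℂ) by push_cast; rfl,
      ← Complex.ofReal_cpow ht.le, ← Complex.ofReal_mul, ← Real.rpow_add ht]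
    norm_num
  rw [h1, one_mul, Complex.ofReal_exp, ← Complex.exp_add]
  congr 1
  push_cast
  field_simp
  ring_nf
  simp only [Complex.I_sq]
  ring

lemma integral_finset_sum_dirac {E : Type*} [NormedAddCommGroup E] [NormedSpace ℝ E] [CompleteSpace E]
    {N : ℕ} (a : Fin N → ℝ) (f : ℝ → E) :
    ∫ x, f x ∂(∑ i, Measure.dirac (a i)) = ∑ i, f (a i) := by
  rw [integral_finsetSum_measure]
  · simp
  · intro i _
    exact integrable_dirac (by simp)

lemma fourier_heat_conv {N : ℕ} (a : Fin N → ℝ) {t : ℝ} (ht : 0 < t) (ξ : ℝ) :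
    𝓕 (fun x => (((∫ y, heatKernel1 t (x - y) ∂(∑ i, Measure.dirac (a i))) : ℝ) : ℂ)) ξ =
      (Real.exp (-π * t * ξ ^ 2) : ℂ) * fourierMeasure (∑ i, Measure.dirac (a i)) ξ := by
  rw [Real.fourier_real_eq_integral_exp_smul, fourierMeasure, integral_finset_sum_dirac]
  simp only [integral_finset_sum_dirac, Complex.ofReal_sum, smul_eq_mul, Finset.mul_sum]
  rw [integral_finsetSum _ fun i _ => (fourier_heat_term ht (a i) ξ).1]
  exact Finset.sum_congr rfl fun i _ => (fourier_heat_term ht (a i) ξ).2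

lemma continuous_fourierMeasure {N : ℕ} (a : Fin N → ℝ) :
    Continuous (fourierMeasure (∑ i, Measure.dirac (a i))) := by
  unfold fourierMeasure
  simp only [integral_finset_sum_dirac]
  fun_prop

lemma Q1_rpow_eq {N : ℕ} (a : Fin N → ℝ) {q t : ℝ} (hq : 0 < q) (ht : 0 < t) :
    Q1 (∑ i, Measure.dirac (a i)) q t ^ q = t ^ (1 / 2 : ℝ) *
      ∫ ξ, Real.exp (-π * (q * t) * ξ ^ 2) *
        ‖fourierMeasure (∑ i, Measure.dirac (a i)) ξ‖ ^ q := by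
  have hc := continuous_fourierMeasure a
  have hf := funext (fourier_heat_conv a ht)
  rw [Q1, hf, toReal_eLpNorm (Continuous.aestronglyMeasurable (by fun_prop)),
    lpNorm_eq_integral_norm_rpow_toReal (by simpa using hq) (by simp)
      (Continuous.aestronglyMeasurable (by fun_prop)), ENNReal.toReal_ofReal hq.le,
    Real.mul_rpow (by positivity) (by positivity), ← Real.rpow_mul ht.le,
    Real.rpow_inv_rpow (by positivity) hq.ne']
  congr 2
  · field_simp
  · funext ξ
    rw [norm_mul, Real.mul_rpow (by positivity) (by positivity), Complex.norm_real,
      Real.norm_of_nonneg (by positivity), ← Real.exp_mul]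
    ring_nf

lemma summable_exp_neg_int_sq {c : ℝ} (hc : 0 < c) (k : ℕ) :
    Summable fun n : ℤ => |(n : ℝ)| ^ k * Real.exp (-π * (n : ℝ) ^ 2 / c) := by
  refine (summable_pow_mul_jacobiTheta₂_term_bound 0 (inv_pos.2 hc) k).congr fun n => ?_
  push_cast
  congr 2
  field_simp
  ring

lemma tsum_exp_neg_add_int_sq {a : ℝ} (ha : 0 < a) (ξ : ℝ) :
    ∑' n : ℤ, (Real.exp (-π * a * (ξ + n) ^ 2) : ℂ) =
      ((a ^ (-(1 / 2) : ℝ) : ℝ) : ℂ) * ∑' n : ℤ,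
        Complex.exp (((-2) * π * n * ξ : ℝ) * Complex.I) *
          (Real.exp (-π * (n : ℝ) ^ 2 / a) : ℂ) := by
  have ha' : (a : ℂ) ≠ 0 := by exact_mod_cast ha.ne'
  have h := Complex.tsum_exp_neg_quadratic (a := ((a⁻¹ : ℝ) : ℂ))
    (by simpa using ha) (-Complex.I * ξ)
  have h1 : ((a⁻¹ : ℝ) : ℂ) ^ (1 / 2 : ℂ) = ((a ^ (-(1 / 2) : ℝ) : ℝ) : ℂ) := by
    rw [show (1 / 2 : ℂ) = ((1 / 2 : ℝ) : ℂ) by push_cast; rfl,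
      ← Complex.ofReal_cpow (by positivity), Real.inv_rpow ha.le, Real.rpow_neg ha.le]
  have h2 : ((a ^ (-(1 / 2) : ℝ) : ℝ) : ℂ) ≠ 0 := by
    exact_mod_cast (Real.rpow_pos_of_pos ha _).ne'
  rw [h1, one_div, eq_inv_mul_iff_mul_eq₀ h2] at h
  trans ∑' n : ℤ, Complex.exp (-π / ((a⁻¹ : ℝ) : ℂ) * (n + Complex.I * (-Complex.I * ξ)) ^ 2)
  · refine tsum_congr fun n => ?_
    rw [Complex.ofReal_exp]
    congr 1
    rw [show Complex.I * (-Complex.I * ξ) = ξ by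
      rw [← mul_assoc, mul_neg, Complex.I_mul_I, neg_neg, one_mul]]
    push_cast
    field_simp
    ring
  · rw [← h]
    congr 1
    refine tsum_congr fun n => ?_
    rw [Complex.ofReal_exp, ← Complex.exp_add]
    congr 1
    push_cast
    field_simp
    ring

lemma norm_fourierCoeff_le {F : ℝ → ℝ} {C : ℝ} (hC : ∀ x, |F x| ≤ C) (n : ℤ) :
    ‖∫ ξ in (0 : ℝ)..1, (F ξ : ℂ) * Complex.exp (((-2) * π * n * ξ : ℝ) * Complex.I)‖ ≤ C := by
  refine (intervalIntegral.norm_integral_le_of_norm_le_const (C := C) fun x _ => ?_).trans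
    (by simp)
  rw [norm_mul, Complex.norm_exp_ofReal_mul_I, mul_one, Complex.norm_real]
  exact hC x

lemma integral_gaussian_mul_periodic {F : ℝ → ℝ} (hF : Continuous F)
    (hper : Function.Periodic F 1) {C : ℝ} (hC : ∀ x, |F x| ≤ C) {a : ℝ} (ha : 0 < a) :
    ((∫ ξ, Real.exp (-π * a * ξ ^ 2) * F ξ : ℝ) : ℂ) =
      ((a ^ (-(1 / 2) : ℝ) : ℝ) : ℂ) * ∑' n : ℤ,
        (∫ ξ in (0 : ℝ)..1, (F ξ : ℂ) * Complex.exp (((-2) * π * n * ξ : ℝ) * Complex.I)) *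
          (Real.exp (-π * (n : ℝ) ^ 2 / a) : ℂ) := by
  have hint : Integrable fun ξ : ℝ => Real.exp (-π * a * ξ ^ 2) := by
    simpa [neg_mul] using integrable_exp_neg_mul_sq (b := π * a) (by positivity)
  have hg : Integrable fun ξ : ℝ => (Real.exp (-π * a * ξ ^ 2) : ℂ) * (F ξ : ℂ) := by
    refine Integrable.mul_bdd (c := C) hint.ofReal
      (Continuous.aestronglyMeasurable (by fun_prop)) (.of_forall fun x => ?_)
    rw [Complex.norm_real]
    exact hC x
  have hperZ (n : ℤ) (x : ℝ) : F (x + n) = F x := by simpa using hper.int_mul n x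
  have hunfold := hg.hasSum_intervalIntegral_comp_add_int
  have hunfold_norm := hg.norm.hasSum_intervalIntegral_comp_add_int
  simp only [hperZ, intervalIntegral.integral_of_le (zero_le_one' ℝ)] at hunfold hunfold_norm
  have hswap := hasSum_integral_of_summable_integral_norm
    (μ := volume.restrict (Set.Ioc (0 : ℝ) 1))
    (F := fun (n : ℤ) (ξ : ℝ) => (Real.exp (-π * a * (ξ + n) ^ 2) : ℂ) * (F ξ : ℂ))
    (fun n => (Continuous.integrableOn_Ioc (by fun_prop))) hunfold_norm.summable
  have hswap' := hasSum_integral_of_summable_integral_norm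
    (μ := volume.restrict (Set.Ioc (0 : ℝ) 1))
    (F := fun (n : ℤ) (ξ : ℝ) =>
      (F ξ : ℂ) * Complex.exp (((-2) * π * n * ξ : ℝ) * Complex.I) *
          (Real.exp (-π * (n : ℝ) ^ 2 / a) : ℂ))
    (fun n => (Continuous.integrableOn_Ioc (by fun_prop))) (by
      refine Summable.of_nonneg_of_le (fun n => integral_nonneg fun x => norm_nonneg _)
        (fun n => ?_) ((summable_exp_neg_int_sq ha 0).mul_left C)
      have : ∀ x ∈ Set.Ioc (0 : ℝ) 1, ‖‖(F x : ℂ) *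
          Complex.exp (((-2) * π * n * x : ℝ) * Complex.I) *
          (Real.exp (-π * (n : ℝ) ^ 2 / a) : ℂ)‖‖ ≤
            C * (|(n : ℝ)| ^ 0 * Real.exp (-π * (n : ℝ) ^ 2 / a)) := by
        intro x _
        rw [norm_norm, norm_mul, norm_mul, Complex.norm_exp_ofReal_mul_I, mul_one,
          Complex.norm_real, Complex.norm_real, pow_zero, one_mul,
          Real.norm_of_nonneg (Real.exp_pos _).le]
        exact mul_le_mul_of_nonneg_right (hC x) (Real.exp_pos _).le
      have h := norm_setIntegral_le_of_norm_le_const (μ := volume)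
        (by simp : volume (Set.Ioc (0 : ℝ) 1) < ⊤) this
      exact (le_abs_self _).trans (by simpa using h))
  rw [← integral_complex_ofReal]
  refine (integral_congr_ae (.of_forall fun ξ => Complex.ofReal_mul _ _)).trans ?_
  rw [← hunfold.tsum_eq, hswap.tsum_eq]
  simp only [intervalIntegral.integral_of_le (zero_le_one' ℝ), ← integral_mul_const]
  rw [hswap'.tsum_eq, ← integral_const_mul]
  congr 1
  funext ξ
  rw [tsum_mul_right, tsum_exp_neg_add_int_sq ha, mul_assoc, ← tsum_mul_right]
  congr 1
  exact tsum_congr fun n => by ring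

lemma hasDerivAt_tsum_mul_exp {c : ℤ → ℂ} {C q t : ℝ} (hc : ∀ n, ‖c n‖ ≤ C) (hq : 0 < q)
    (ht : 0 < t) :
    HasDerivAt (fun s : ℝ => ∑' n : ℤ, c n * (Real.exp (-π * (n : ℝ) ^ 2 / (q * s)) : ℂ))
      (∑' n : ℤ, c n * ((Real.exp (-π * (n : ℝ) ^ 2 / (q * t)) *
        (π * (n : ℝ) ^ 2 / (q * t ^ 2)) : ℝ) : ℂ)) t := by
  have hC : 0 ≤ C := (norm_nonneg _).trans (hc 0)
  refine hasDerivAt_tsum_of_isPreconnected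
    (g := fun (n : ℤ) (s : ℝ) => c n * (Real.exp (-π * (n : ℝ) ^ 2 / (q * s)) : ℂ))
    (g' := fun (n : ℤ) (s : ℝ) => c n * ((Real.exp (-π * (n : ℝ) ^ 2 / (q * s)) *
        (π * (n : ℝ) ^ 2 / (q * s ^ 2)) : ℝ) : ℂ))
    (u := fun n : ℤ => C * (π / (q * (t / 2) ^ 2)) *
      (|(n : ℝ)| ^ 2 * Real.exp (-π * (n : ℝ) ^ 2 / (q * (2 * t)))))
    (t := Set.Ioo (t / 2) (2 * t)) (y₀ := t)
    ((summable_exp_neg_int_sq (by positivity) 2).mul_left _) isOpen_Ioo isPreconnected_Ioo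
    (fun n s hs => ?_) (fun n s hs => ?_) ⟨by linarith, by linarith⟩ ?_
    ⟨by linarith, by linarith⟩
  · have hs0 : 0 < s := by linarith [hs.1]
    have h1 : HasDerivAt (fun s : ℝ => -π * (n : ℝ) ^ 2 / (q * s))
        (π * (n : ℝ) ^ 2 / (q * s ^ 2)) s := by
      have h := ((hasDerivAt_id s).const_mul q).fun_inv (by simp [hq.ne', hs0.ne'])
      convert! h.const_mul (-π * (n : ℝ) ^ 2) using 1
      simp only [id]
      field_simp
    exact h1.exp.ofReal_comp.const_mul _
  · have hs0 : 0 < s := by linarith [hs.1]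
    rw [norm_mul, Complex.norm_real, Real.norm_of_nonneg (by positivity), sq_abs, mul_assoc C]
    refine mul_le_mul (hc n) ?_ (by positivity) hC
    have e1 : Real.exp (-π * (n : ℝ) ^ 2 / (q * s)) ≤
        Real.exp (-π * (n : ℝ) ^ 2 / (q * (2 * t))) := by
      rw [neg_mul, neg_div, neg_div]
      have := hs.2.le
      gcongr
    have e2 : π * (n : ℝ) ^ 2 / (q * s ^ 2) ≤ π * (n : ℝ) ^ 2 / (q * (t / 2) ^ 2) := by
      have := hs.1.le
      gcongr
    calc _ ≤ Real.exp (-π * (n : ℝ) ^ 2 / (q * (2 * t))) *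
          (π * (n : ℝ) ^ 2 / (q * (t / 2) ^ 2)) := by gcongr
      _ = _ := by ring
  · refine Summable.of_norm_bounded ((summable_exp_neg_int_sq (c := q * t) (by positivity) 0).mul_left C)
      fun n => ?_
    rw [norm_mul, Complex.norm_real, Real.norm_of_nonneg (by positivity), pow_zero, one_mul]
    exact mul_le_mul_of_nonneg_right (hc n) (by positivity)

lemma tsum_int_eq_add_tsum_two_le {E : Type*} [NormedAddCommGroup E]
    {f : ℤ → E} (hf : Summable f) (h0 : f 0 = 0) :
    ∑' n, f n = f 1 + f (-1) + ∑' n : ℕ, if 2 ≤ n then f n + f (-n) else 0 := by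
  have h := tsum_nat_add_neg hf
  rw [h0, add_zero] at h
  rw [← h, hf.nat_add_neg.tsum_eq_add_tsum_ite 1]
  congr 1
  refine tsum_congr fun n => ?_
  rcases n with _ | _ | n
  · simp [h0]
  · simp
  · simp

lemma norm_fourierMeasure_le {N : ℕ} (a : Fin N → ℝ) (ξ : ℝ) :
    ‖fourierMeasure (∑ i, Measure.dirac (a i)) ξ‖ ≤ N := by
  unfold fourierMeasure
  rw [integral_finset_sum_dirac]
  refine (norm_sum_le _ _).trans ?_
  simp only [Complex.norm_exp_ofReal_mul_I]
  simp

lemma periodic_fourierMeasure {N : ℕ} (a : Fin N → ℤ) :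
    Function.Periodic (fourierMeasure (∑ i, Measure.dirac (a i : ℝ))) 1 := by
  intro ξ
  unfold fourierMeasure
  simp only [integral_finset_sum_dirac]
  refine Finset.sum_congr rfl fun i _ => Complex.exp_eq_exp_iff_exists_int.2 ⟨-a i, ?_⟩
  push_cast
  ring

lemma Q1_rpow_eq_tsum {N : ℕ} (a : Fin N → ℤ) {q t : ℝ} (hq : 0 < q) (ht : 0 < t) :
    ((Q1 (∑ i, Measure.dirac (a i : ℝ)) q t ^ q : ℝ) : ℂ) = ((q ^ (-(1 / 2) : ℝ) : ℝ) : ℂ) *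
      ∑' n : ℤ, cCoeff (∑ i, Measure.dirac (a i : ℝ)) q n *
        (Real.exp (-π * (n : ℝ) ^ 2 / (q * t)) : ℂ) := by
  have hcont := continuous_fourierMeasure (fun i => (a i : ℝ))
  rw [Q1_rpow_eq _ hq ht, Complex.ofReal_mul, integral_gaussian_mul_periodic
    (F := fun ξ => ‖fourierMeasure (∑ i, Measure.dirac (a i : ℝ)) ξ‖ ^ q)
    (C := (N : ℝ) ^ q) (hcont.norm.rpow_const fun _ => .inr hq.le)
    (fun ξ => by simp only [periodic_fourierMeasure a ξ])
    (fun ξ => ?_) (mul_pos hq ht), ← mul_assoc, ← Complex.ofReal_mul,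
    Real.mul_rpow hq.le ht.le, mul_left_comm, ← Real.rpow_add ht]
  · norm_num [cCoeff]
  · rw [abs_of_nonneg (by positivity)]
    exact Real.rpow_le_rpow (norm_nonneg _) (norm_fourierMeasure_le _ ξ) hq.le

/-- for `μ` a finite sum of Dirac deltas at integers and `q > 2`, the function
`t ↦ Q_{1,q}(t)^q` is differentiable on `(0,∞)` with derivative
`(π/q^{3/2}) t^{-2} Σ_{n ≠ 0} n² c_n e^{-πn²/(qt)}
  = (π/q^{3/2}) t^{-2} e^{-π/(qt)} (c₁ + c₋₁ + Σ_{n ≥ 2} n²(c_n + c_{-n}) e^{-π(n²-1)/(qt)})`. -/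
theorem statement4 (q : ℝ) (hq : 2 < q) (μ : Measure ℝ)
    (hμ : ∃ (N : ℕ) (a : Fin N → ℤ), μ = ∑ i, Measure.dirac ((a i : ℝ))) :
    ∃ D : ℝ → ℝ,
      (∀ t : ℝ, 0 < t → HasDerivAt (fun s => Q1 μ q s ^ q) (D t) t) ∧
      (∀ t : ℝ, 0 < t →
        ((D t : ℝ) : ℂ) =
            ((π / q ^ ((3 : ℝ) / 2) : ℝ) : ℂ) * ((t ^ (-2 : ℤ) : ℝ) : ℂ) *
              ∑' n : {n : ℤ // n ≠ 0},
                (((n : ℤ) : ℝ) : ℂ) ^ 2 * cCoeff μ q n *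
                  ((Real.exp (-π * ((n : ℤ) : ℝ) ^ 2 / (q * t)) : ℝ) : ℂ) ∧
          ((D t : ℝ) : ℂ) =
            ((π / q ^ ((3 : ℝ) / 2) : ℝ) : ℂ) * ((t ^ (-2 : ℤ) : ℝ) : ℂ) *
              ((Real.exp (-π / (q * t)) : ℝ) : ℂ) *
              (cCoeff μ q 1 + cCoeff μ q (-1) +
                ∑' n : ℕ,
                  if 2 ≤ n then
                    ((n : ℝ) : ℂ) ^ 2 * (cCoeff μ q n + cCoeff μ q (-(n : ℤ))) *
                      ((Real.exp (-π * ((n : ℝ) ^ 2 - 1) / (q * t)) : ℝ) : ℂ)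
                  else 0)) := by
  obtain ⟨N, a, rfl⟩ := hμ
  have hq0 : 0 < q := by linarith
  set μ : Measure ℝ := ∑ i, Measure.dirac (a i : ℝ) with hμ
  have hc : ∀ n, ‖cCoeff μ q n‖ ≤ (N : ℝ) ^ q := norm_fourierCoeff_le fun ξ => by
    rw [abs_of_nonneg (by positivity)]
    exact Real.rpow_le_rpow (norm_nonneg _) (norm_fourierMeasure_le _ ξ) hq0.le
  set f : ℝ → ℤ → ℂ := fun t n => ((n : ℝ) : ℂ) ^ 2 * cCoeff μ q n *
    ((Real.exp (-π * (n : ℝ) ^ 2 / (q * t)) : ℝ) : ℂ) with hf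
  set K : ℝ → ℂ := fun t => ((π / q ^ ((3 : ℝ) / 2) : ℝ) : ℂ) * ((t ^ (-2 : ℤ) : ℝ) : ℂ) with hK
  have hQ : ∀ t : ℝ, 0 < t →
      HasDerivAt (fun s => ((Q1 μ q s ^ q : ℝ) : ℂ)) (K t * ∑' n, f t n) t := by
    intro t ht
    have h := ((hasDerivAt_tsum_mul_exp hc hq0 ht).const_mul
      ((q ^ (-(1 / 2) : ℝ) : ℝ) : ℂ)).congr_of_eventuallyEq
        ((eventually_gt_nhds ht).mono fun s hs => Q1_rpow_eq_tsum a hq0 hs)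
    convert! h using 1
    rw [← tsum_mul_left, ← tsum_mul_left]
    refine tsum_congr fun n => ?_
    have hK' : K t = ((q ^ (-(1 / 2) : ℝ) * (π / (q * t ^ 2)) : ℝ) : ℂ) := by
      simp only [hK]
      rw [← Complex.ofReal_mul, Real.rpow_neg hq0.le, show (3 : ℝ) / 2 = 1 + 1 / 2 by norm_num,
        Real.rpow_add hq0, Real.rpow_one, zpow_neg]
      congr 1
      norm_cast
      field_simp
    rw [hK', hf]
    push_cast
    ring
  have hreal : ∀ t : ℝ, 0 < t →
      HasDerivAt (fun s => Q1 μ q s ^ q) (K t * ∑' n, f t n).re t := fun t ht =>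
    Complex.reCLM.hasFDerivAt.comp_hasDerivAt t (hQ t ht)
  refine ⟨fun t => (K t * ∑' n, f t n).re, hreal, fun t ht => ?_⟩
  have hD : (((K t * ∑' n, f t n).re : ℝ) : ℂ) = K t * ∑' n, f t n :=
    (hreal t ht).ofReal_comp.unique (hQ t ht)
  have h0 : f t 0 = 0 := by simp [hf]
  have hsum : Summable (f t) := by
    refine Summable.of_norm_bounded
      ((summable_exp_neg_int_sq (c := q * t) (by positivity) 2).mul_left ((N : ℝ) ^ q)) fun n => ?_
    rw [hf, norm_mul, norm_mul, norm_pow, Complex.norm_real, Complex.norm_real, Real.norm_eq_abs,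
      Real.norm_of_nonneg (Real.exp_pos _).le, mul_comm (_ ^ 2), mul_assoc]
    exact mul_le_mul_of_nonneg_right (hc n) (by positivity)
  have hexp (n : ℝ) : ((Real.exp (-π * n ^ 2 / (q * t)) : ℝ) : ℂ) =
      ((Real.exp (-π / (q * t)) : ℝ) : ℂ) *
        ((Real.exp (-π * (n ^ 2 - 1) / (q * t)) : ℝ) : ℂ) := by
    rw [← Complex.ofReal_mul, ← Real.exp_add]
    congr 2
    ring
  simp only [hD]
  constructor
  · congr 1
    refine (Subtype.val_injective.tsum_eq fun n hn => ?_).symm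
    simp only [Subtype.range_coe_subtype, Set.mem_ofPred_eq]
    rintro rfl
    exact hn h0
  · rw [mul_assoc (K t)]
    congr 1
    rw [tsum_int_eq_add_tsum_two_le hsum h0, mul_add, ← tsum_mul_left]
    congr 1
    · simp [hf]
      ring
    · refine tsum_congr fun n => ?_
      split_ifs
      · simp only [hf, Int.cast_neg, Int.cast_natCast, neg_sq, hexp]
        push_cast
        ring
      · simp
end

section
/- Let q > 2 and let μ be a finite sum of Dirac delta measures on ℝ, each supported at an integer, with Fourier coefficients c_n = ∫₀¹ |μ̂(ξ)|^q e^{−2πinξ} dξ of |μ̂|^q. If c₁ + c₋₁ < 0, then Q_{1,q}(t) is strictly decreasing for all sufficiently small t > 0. -/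
open MeasureTheory Real Filter
open scoped FourierTransform ENNReal Topology

lemma pow_succ_sub_pow_succ_le {x y : ℝ} (hx : 0 ≤ x) (hxy : x ≤ y) (k : ℕ) :
    y ^ (k + 1) - x ^ (k + 1) ≤ (k + 1) * y ^ k * (y - x) := by
  induction k with
  | zero => simp
  | succ k ih =>
    have hy : 0 ≤ y := hx.trans hxy
    have h : x ^ (k + 1) * (y - x) ≤ y ^ (k + 1) * (y - x) := by
      gcongr
    calc y ^ (k + 1 + 1) - x ^ (k + 1 + 1)
        = y * (y ^ (k + 1) - x ^ (k + 1)) + x ^ (k + 1) * (y - x) := by ring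
      _ ≤ y * ((k + 1) * y ^ k * (y - x)) + y ^ (k + 1) * (y - x) := by gcongr
      _ = _ := by push_cast; ring

lemma exp_neg_pi_mul_sq (s : ℝ) (m : ℕ) :
    Real.exp (-π * ((m : ℝ) + 1) ^ 2 * s) = Real.exp (-π * s) ^ ((m + 1) ^ 2) := by
  rw [← Real.exp_nat_mul]
  congr 1
  push_cast
  ring

/-- First-order control of the increments of the cosine theta kernel in the nome
`e^{-πs}`. -/
lemma exists_cosKernel_sub_le : ∃ C : ℝ, 0 ≤ C ∧ ∀ a s₁ s₂ : ℝ, 0 < s₂ → s₂ ≤ s₁ →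
    Real.exp (-π * s₂) ≤ 1 / 2 →
    HurwitzZeta.cosKernel a s₂ - HurwitzZeta.cosKernel a s₁ ≤
      (2 * Real.cos (2 * π * a) + C * Real.exp (-π * s₂)) *
        (Real.exp (-π * s₂) - Real.exp (-π * s₁)) := by
  have hb : Summable fun n : ℕ => 2 * (((n : ℝ) + 2) ^ 2 * (1 / 2) ^ n) := by
    have h0 := summable_pow_mul_geometric_of_norm_lt_one (R := ℝ) 0 (r := 1 / 2) (by norm_num)
    have h1 := summable_pow_mul_geometric_of_norm_lt_one (R := ℝ) 1 (r := 1 / 2) (by norm_num)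
    have h2 := summable_pow_mul_geometric_of_norm_lt_one (R := ℝ) 2 (r := 1 / 2) (by norm_num)
    refine (((h2.add (h1.mul_left 4)).add (h0.mul_left 4)).mul_left 2).congr fun n => ?_
    ring
  refine ⟨∑' n : ℕ, 2 * (((n : ℝ) + 2) ^ 2 * (1 / 2) ^ n),
    tsum_nonneg fun n => by positivity, ?_⟩
  intro a s₁ s₂ hs₂ hs hy2
  have hxy : Real.exp (-π * s₁) ≤ Real.exp (-π * s₂) := by
    apply Real.exp_le_exp.2
    nlinarith [Real.pi_pos]
  have hx : 0 ≤ Real.exp (-π * s₁) := (Real.exp_pos _).le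
  have h1 := HurwitzZeta.hasSum_nat_cosKernel₀ a (hs₂.trans_le hs)
  have h2 := HurwitzZeta.hasSum_nat_cosKernel₀ a hs₂
  simp only [exp_neg_pi_mul_sq] at h1 h2
  set x := Real.exp (-π * s₁)
  set y := Real.exp (-π * s₂)
  have h := (hasSum_nat_add_iff' 1).2 (h2.sub h1)
  have hle := hasSum_le ?_ h (hb.hasSum.mul_right (y * (y - x)))
  · simp only [Finset.range_one, Finset.sum_singleton, Nat.cast_zero, zero_add, mul_one,
      one_pow, pow_one] at hle
    linarith
  · intro n
    have hy : 0 ≤ y := hx.trans hxy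
    have hyx : 0 ≤ y - x := by linarith
    have hpow : x ^ (n + 1 + 1) ^ 2 ≤ y ^ (n + 1 + 1) ^ 2 := by gcongr
    have hk : (n + 1 + 1) ^ 2 = (n ^ 2 + 4 * n + 3) + 1 := by ring
    have hbd : y ^ (n + 1 + 1) ^ 2 - x ^ (n + 1 + 1) ^ 2 ≤
        ((n : ℝ) + 2) ^ 2 * (1 / 2) ^ n * (y * (y - x)) := by
      calc y ^ (n + 1 + 1) ^ 2 - x ^ (n + 1 + 1) ^ 2
          ≤ ((n ^ 2 + 4 * n + 3 : ℕ) + 1) * y ^ (n ^ 2 + 4 * n + 3) * (y - x) := by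
            rw [hk]; exact pow_succ_sub_pow_succ_le hx hxy _
        _ ≤ ((n ^ 2 + 4 * n + 3 : ℕ) + 1) * y ^ (n + 1) * (y - x) := by
            gcongr ?_ * ?_ * _
            exact pow_le_pow_of_le_one hy (by linarith) (by nlinarith)
        _ ≤ ((n ^ 2 + 4 * n + 3 : ℕ) + 1) * ((1 / 2) ^ n * y) * (y - x) := by
            rw [pow_succ y n]; gcongr
        _ = _ := by push_cast; ring
    have hcos := Real.cos_le_one (2 * π * a * ((n + 1 : ℕ) + 1))
    calc 2 * Real.cos (2 * π * a * ((n + 1 : ℕ) + 1)) * y ^ (n + 1 + 1) ^ 2 -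
          2 * Real.cos (2 * π * a * ((n + 1 : ℕ) + 1)) * x ^ (n + 1 + 1) ^ 2
        = 2 * (Real.cos (2 * π * a * ((n + 1 : ℕ) + 1)) *
            (y ^ (n + 1 + 1) ^ 2 - x ^ (n + 1 + 1) ^ 2)) := by ring
      _ ≤ 2 * (y ^ (n + 1 + 1) ^ 2 - x ^ (n + 1 + 1) ^ 2) := by
          gcongr
          exact mul_le_of_le_one_left (by linarith) hcos
      _ ≤ 2 * (((n : ℝ) + 2) ^ 2 * (1 / 2) ^ n * (y * (y - x))) := by gcongr
      _ = _ := by ring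

lemma continuous_cosKernel {s : ℝ} (hs : 0 < s) :
    Continuous fun a : ℝ => HurwitzZeta.cosKernel a s := by
  have h : (fun a : ℝ => HurwitzZeta.cosKernel a s) =
      fun a : ℝ => (jacobiTheta₂ a (Complex.I * s)).re := by
    ext a
    rw [← HurwitzZeta.cosKernel_def, Complex.ofReal_re]
  rw [h]
  refine Complex.continuous_re.comp (continuous_iff_continuousAt.2 fun a => ?_)
  exact (differentiableAt_jacobiTheta₂_fst (a : ℂ) (by simpa)).continuousAt.comp
    (f := fun u : ℝ => (u : ℂ)) Complex.continuous_ofReal.continuousAt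

/-- Unfolding of a Gaussian integral against a periodic function. -/
lemma integral_gaussian_mul_periodic_s5 {f : ℝ → ℝ} (hf : Continuous f) (hf0 : ∀ x, 0 ≤ f x)
    (hp : Function.Periodic f 1) {M : ℝ} (hM : ∀ x, f x ≤ M) {b : ℝ} (hb : 0 < b) :
    ∫ x, Real.exp (-π * x ^ 2 * b) * f x =
      ∫ x in (0 : ℝ)..1, HurwitzZeta.evenKernel x b * f x := by
  have hint : Integrable fun x : ℝ => Real.exp (-π * x ^ 2 * b) * f x := by
    have hg : Integrable fun x : ℝ => Real.exp (-π * x ^ 2 * b) := by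
      refine (integrable_exp_neg_mul_sq (b := π * b) (by positivity)).congr (.of_forall fun x => ?_)
      ring_nf
    refine (hg.mul_const M).mono' (by fun_prop) (.of_forall fun x => ?_)
    rw [Real.norm_of_nonneg (mul_nonneg (Real.exp_pos _).le (hf0 x))]
    gcongr
    exact hM x
  have h1 := hint.hasSum_intervalIntegral_comp_add_int
  have hper (n : ℤ) (x : ℝ) : f (x + n) = f x := by simpa using hp.int_mul n x
  simp only [hper, intervalIntegral.integral_of_le zero_le_one] at h1 ⊢
  have h2 := hasSum_integral_of_summable_integral_norm (μ := volume.restrict (Set.Ioc (0 : ℝ) 1))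
    (F := fun (n : ℤ) (x : ℝ) => Real.exp (-π * (x + n) ^ 2 * b) * f x)
    (fun n => Continuous.integrableOn_Ioc (by fun_prop)) ?_
  · refine (h1.unique h2).trans (integral_congr_ae (.of_forall fun x => ?_))
    have := (HurwitzZeta.hasSum_int_evenKernel x hb).mul_right (f x)
    simp only [add_comm (_ : ℝ) x] at this
    exact this.tsum_eq
  · refine h1.summable.congr fun n => integral_congr_ae (.of_forall fun x => ?_)
    exact (Real.norm_of_nonneg (mul_nonneg (Real.exp_pos _).le (hf0 x))).symm

lemma cosKernel_nonneg (a : ℝ) {s : ℝ} (hs : 0 < s) : 0 ≤ HurwitzZeta.cosKernel a s := by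
  have h0 := (HurwitzZeta.hasSum_int_evenKernel a (one_div_pos.2 hs)).nonneg
    fun n => (Real.exp_pos _).le
  rw [HurwitzZeta.evenKernel_functional_equation, one_div_one_div] at h0
  exact nonneg_of_mul_nonneg_right h0 (by positivity)

lemma fourierMeasure_sum_dirac {N : ℕ} (a : Fin N → ℤ) (ξ : ℝ) :
    fourierMeasure (∑ i, Measure.dirac ((a i : ℝ))) ξ =
      ∑ i, Complex.exp (((-2) * π * a i * ξ : ℝ) * Complex.I) := by
  rw [fourierMeasure, integral_finsetSum_measure fun i _ => integrable_dirac (by simp)]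
  simp only [integral_dirac]

lemma continuous_fourierMeasure_sum_dirac {N : ℕ} (a : Fin N → ℤ) :
    Continuous (fourierMeasure (∑ i, Measure.dirac ((a i : ℝ)))) := by
  rw [funext (fourierMeasure_sum_dirac a)]
  fun_prop

lemma periodic_fourierMeasure_sum_dirac {N : ℕ} (a : Fin N → ℤ) :
    Function.Periodic (fourierMeasure (∑ i, Measure.dirac ((a i : ℝ)))) 1 := by
  intro ξ
  simp only [fourierMeasure_sum_dirac]
  refine Finset.sum_congr rfl fun i _ => Complex.exp_eq_exp_iff_exists_int.2 ⟨-a i, ?_⟩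
  push_cast
  ring

lemma norm_fourierMeasure_sum_dirac_le {N : ℕ} (a : Fin N → ℤ) (ξ : ℝ) :
    ‖fourierMeasure (∑ i, Measure.dirac ((a i : ℝ))) ξ‖ ≤ N := by
  rw [fourierMeasure_sum_dirac]
  refine (norm_sum_le _ _).trans ?_
  simp only [Complex.norm_exp_ofReal_mul_I]
  simp

lemma heatKernel1_sub_eq {t : ℝ} (ht : 0 < t) (a x : ℝ) :
    ((heatKernel1 t (x - a) : ℝ) : ℂ) =
      ((t ^ (-(1 : ℝ) / 2) * Real.exp (-π * a ^ 2 / t) : ℝ) : ℂ) *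
        Complex.exp (-π * ((1 / t : ℝ) : ℂ) * x ^ 2 + 2 * π * ((a / t : ℝ) : ℂ) * x) := by
  have : (t : ℂ) ≠ 0 := by exact_mod_cast ht.ne'
  rw [heatKernel1]
  push_cast
  rw [mul_assoc, ← Complex.exp_add]
  congr 2
  field_simp
  ring

lemma integrable_heatKernel1_sub {t : ℝ} (ht : 0 < t) (a : ℝ) :
    Integrable fun x => ((heatKernel1 t (x - a) : ℝ) : ℂ) := by
  simp only [heatKernel1_sub_eq ht]
  refine Integrable.const_mul ?_ _
  have := integrable_cexp_quadratic (b := π * ((1 / t : ℝ) : ℂ))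
    (by rw [← Complex.ofReal_mul, Complex.ofReal_re]; positivity)
    (2 * π * ((a / t : ℝ) : ℂ)) 0
  simpa only [neg_mul, add_zero] using this

lemma fourier_heatKernel1_sub {t : ℝ} (ht : 0 < t) (a ξ : ℝ) :
    𝓕 (fun x => ((heatKernel1 t (x - a) : ℝ) : ℂ)) ξ =
      Real.exp (-π * t * ξ ^ 2) * Complex.exp (((-2) * π * a * ξ : ℝ) * Complex.I) := by
  have ht0 : (t : ℂ) ≠ 0 := by exact_mod_cast ht.ne'
  have hre : 0 < ((1 / t : ℝ) : ℂ).re := by rw [Complex.ofReal_re]; positivity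
  have hsq : (((1 / t : ℝ) : ℂ)) ^ (1 / 2 : ℂ) = ((t ^ (-(1 : ℝ) / 2) : ℝ) : ℂ) := by
    rw [show (1 / 2 : ℂ) = ((1 / 2 : ℝ) : ℂ) by push_cast; rfl,
      ← Complex.ofReal_cpow (by positivity), one_div, Real.inv_rpow ht.le, neg_div,
      Real.rpow_neg ht.le]
  have hpos : ((t ^ (-(1 : ℝ) / 2) : ℝ) : ℂ) ≠ 0 := by
    exact_mod_cast (Real.rpow_pos_of_pos ht _).ne'
  have h := congrFun (fourier_gaussian_pi' hre ((a / t : ℝ) : ℂ)) ξ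
  have hsmul : 𝓕 (fun x => ((heatKernel1 t (x - a) : ℝ) : ℂ)) ξ =
      ((t ^ (-(1 : ℝ) / 2) * Real.exp (-π * a ^ 2 / t) : ℝ) : ℂ) *
        𝓕 (fun x : ℝ => Complex.exp (-π * ((1 / t : ℝ) : ℂ) * x ^ 2 +
          2 * π * ((a / t : ℝ) : ℂ) * x)) ξ := by
    simp only [heatKernel1_sub_eq ht, Real.fourier_real_eq_integral_exp_smul, smul_eq_mul]
    rw [← integral_const_mul]
    exact integral_congr_ae (.of_forall fun x => by ring)
  rw [hsmul, h, hsq]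
  push_cast
  rw [mul_mul_mul_comm, mul_one_div_cancel (by exact_mod_cast hpos), one_mul,
    ← Complex.exp_add, ← Complex.exp_add]
  congr 1
  field_simp
  ring_nf
  simp only [Complex.I_sq]
  ring

/-- The Fourier transform of `H_t ∗ μ` for a finite sum of Dirac masses. -/
lemma fourier_heatKernel1_conv_sum_dirac {N : ℕ} (a : Fin N → ℤ) {t : ℝ} (ht : 0 < t) (ξ : ℝ) :
    𝓕 (fun x => (((∫ y, heatKernel1 t (x - y) ∂(∑ i, Measure.dirac ((a i : ℝ)))) : ℝ) : ℂ)) ξ =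
      Real.exp (-π * t * ξ ^ 2) * fourierMeasure (∑ i, Measure.dirac ((a i : ℝ))) ξ := by
  have h (x : ℝ) : (((∫ y, heatKernel1 t (x - y) ∂(∑ i, Measure.dirac ((a i : ℝ)))) : ℝ) : ℂ) =
      ∑ i, ((heatKernel1 t (x - a i) : ℝ) : ℂ) := by
    rw [integral_finsetSum_measure fun i _ => integrable_dirac (by simp)]
    simp only [integral_dirac]
    push_cast
    rfl
  simp only [h, fourierMeasure_sum_dirac, Finset.mul_sum, ← fourier_heatKernel1_sub ht]
  simp only [Real.fourier_eq, Finset.smul_sum]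
  exact integral_finsetSum _ fun i _ =>
    (Real.fourierIntegral_convergent_iff ξ).2 (integrable_heatKernel1_sub ht (a i))

/-- Poisson summation: `Q_{1,q}` as an integral over a period against the theta kernel. -/
lemma Q1_sum_dirac_eq {N : ℕ} (a : Fin N → ℤ) {q t : ℝ} (hq : 0 < q) (ht : 0 < t) :
    Q1 (∑ i, Measure.dirac ((a i : ℝ))) q t =
      (1 / q ^ (1 / 2 : ℝ) * ∫ ξ in (0 : ℝ)..1, HurwitzZeta.cosKernel ξ (1 / (q * t)) *
        ‖fourierMeasure (∑ i, Measure.dirac ((a i : ℝ))) ξ‖ ^ q) ^ (1 / q) := by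
  have hcont := continuous_fourierMeasure_sum_dirac a
  have hper := periodic_fourierMeasure_sum_dirac a
  have hbd := norm_fourierMeasure_sum_dirac_le a
  have hF := funext (fourier_heatKernel1_conv_sum_dirac a ht)
  rw [Q1, hF]
  set F := fourierMeasure (∑ i, Measure.dirac ((a i : ℝ)))
  have hmeas : AEStronglyMeasurable (fun ξ : ℝ => (Real.exp (-π * t * ξ ^ 2) : ℂ) * F ξ) volume :=
    Continuous.aestronglyMeasurable (by fun_prop)
  have hnorm (ξ : ℝ) : ‖(Real.exp (-π * t * ξ ^ 2) : ℂ) * F ξ‖ ^ q =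
      Real.exp (-π * ξ ^ 2 * (q * t)) * ‖F ξ‖ ^ q := by
    rw [norm_mul, Complex.norm_real, Real.norm_of_nonneg (Real.exp_pos _).le,
      Real.mul_rpow (Real.exp_pos _).le (norm_nonneg _), ← Real.exp_mul]
    ring_nf
  rw [toReal_eLpNorm hmeas, lpNorm_eq_integral_norm_rpow_toReal (by simpa using hq) (by simp) hmeas,
    ENNReal.toReal_ofReal hq.le]
  simp only [hnorm]
  have h1 : t ^ (1 / (2 * q)) = (t ^ (1 / 2 : ℝ)) ^ q⁻¹ := by
    rw [← Real.rpow_mul ht.le]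
    congr 1
    field_simp
  have ht' : 0 < t ^ (1 / 2 : ℝ) := Real.rpow_pos_of_pos ht _
  rw [h1, ← Real.mul_rpow ht'.le (integral_nonneg fun x => by positivity), one_div q,
    integral_gaussian_mul_periodic_s5 (f := fun ξ => ‖F ξ‖ ^ q) (M := (N : ℝ) ^ q)
    (hcont.norm.rpow_const fun _ => .inr hq.le) (fun x => by positivity)
    (fun x => by simp only [hper x])
    (fun x => Real.rpow_le_rpow (norm_nonneg _) (hbd x) hq.le) (by positivity)]
  simp only [HurwitzZeta.evenKernel_functional_equation, mul_assoc,
    intervalIntegral.integral_const_mul]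
  rw [Real.mul_rpow hq.le ht.le]
  congr 1
  field_simp

lemma cCoeff_one_add_neg_one {μ : Measure ℝ} {q : ℝ} (hq : 0 ≤ q)
    (hcont : Continuous (fourierMeasure μ)) :
    cCoeff μ q 1 + cCoeff μ q (-1) =
      ((∫ ξ in (0 : ℝ)..1, 2 * Real.cos (2 * π * ξ) * ‖fourierMeasure μ ξ‖ ^ q : ℝ) : ℂ) := by
  have hf : Continuous fun ξ => ‖fourierMeasure μ ξ‖ ^ q :=
    hcont.norm.rpow_const fun _ => .inr hq
  rw [cCoeff, cCoeff, ← intervalIntegral.integral_add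
    (Continuous.intervalIntegrable (by fun_prop) _ _)
    (Continuous.intervalIntegrable (by fun_prop) _ _), ← intervalIntegral.integral_ofReal]
  refine intervalIntegral.integral_congr fun ξ _ => ?_
  push_cast
  rw [Complex.two_cos]
  ring_nf

/-- for `μ` a finite sum of Dirac deltas at integers and `q > 2`, if
`c₁ + c₋₁ < 0` then `Q_{1,q}(t)` is strictly decreasing for sufficiently small `t > 0`. -/
theorem statement5 (q : ℝ) (hq : 2 < q) (μ : Measure ℝ)
    (hμ : ∃ (N : ℕ) (a : Fin N → ℤ), μ = ∑ i, Measure.dirac ((a i : ℝ)))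
    (hc : ∃ γ : ℝ, γ < 0 ∧ cCoeff μ q 1 + cCoeff μ q (-1) = (γ : ℂ)) :
    ∃ t₀ > 0, StrictAntiOn (Q1 μ q) (Set.Ioo 0 t₀) := by
  obtain ⟨N, a, rfl⟩ := hμ
  obtain ⟨γ, hγ, hc⟩ := hc
  have hq0 : 0 < q := by linarith
  have hcont := continuous_fourierMeasure_sum_dirac a
  have hf : Continuous fun ξ => ‖fourierMeasure (∑ i, Measure.dirac ((a i : ℝ))) ξ‖ ^ q :=
    hcont.norm.rpow_const fun _ => .inr hq0.le
  rw [cCoeff_one_add_neg_one hq0.le hcont] at hc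
  replace hc := Complex.ofReal_injective hc
  obtain ⟨C, hC0, hC⟩ := exists_cosKernel_sub_le
  have hQ0 (t : ℝ) (ht : 0 < t) := Q1_sum_dirac_eq a hq0 ht
  set f := fun ξ => ‖fourierMeasure (∑ i, Measure.dirac ((a i : ℝ))) ξ‖ ^ q
  have hf0 (ξ : ℝ) : 0 ≤ f ξ := by positivity
  set I := ∫ ξ in (0 : ℝ)..1, f ξ
  have hI0 : 0 ≤ I := intervalIntegral.integral_nonneg zero_le_one fun ξ _ => hf0 ξ
  set J : ℝ → ℝ := fun s => ∫ ξ in (0 : ℝ)..1, HurwitzZeta.cosKernel ξ s * f ξ with hJ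
  have hJint {s : ℝ} (hs : 0 < s) :
      IntervalIntegrable (fun ξ : ℝ => HurwitzZeta.cosKernel ξ s * f ξ) volume 0 1 :=
    ((continuous_cosKernel hs).mul hf).intervalIntegrable _ _
  have hJsub {s₁ s₂ : ℝ} (h2 : 0 < s₂) (hs : s₂ ≤ s₁) (hy : Real.exp (-π * s₂) ≤ 1 / 2) :
      J s₂ - J s₁ ≤ (γ + C * Real.exp (-π * s₂) * I) *
        (Real.exp (-π * s₂) - Real.exp (-π * s₁)) := by
    have hle : J s₂ - J s₁ ≤ ∫ ξ in (0 : ℝ)..1,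
        (2 * Real.cos (2 * π * ξ) * f ξ + C * Real.exp (-π * s₂) * f ξ) *
          (Real.exp (-π * s₂) - Real.exp (-π * s₁)) := by
      rw [hJ, ← intervalIntegral.integral_sub (hJint h2) (hJint (h2.trans_le hs))]
      refine intervalIntegral.integral_mono_on zero_le_one
        ((hJint h2).sub (hJint (h2.trans_le hs)))
        (Continuous.intervalIntegrable (by fun_prop) _ _) fun ξ _ => ?_
      have := mul_le_mul_of_nonneg_right (hC ξ s₁ s₂ h2 hs hy) (hf0 ξ)
      linarith
    rwa [intervalIntegral.integral_mul_const, intervalIntegral.integral_add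
      (Continuous.intervalIntegrable (by fun_prop) _ _)
      (Continuous.intervalIntegrable (by fun_prop) _ _),
      intervalIntegral.integral_const_mul, hc] at hle
  have hCI : 0 ≤ C * I := mul_nonneg hC0 hI0
  obtain ⟨δ, hδ, hδ'⟩ : ∃ δ > 0, δ * (C * I + 1) < -γ := by
    refine ⟨-γ / (2 * (C * I + 1)), div_pos (by linarith) (by linarith), ?_⟩
    rw [div_mul_eq_mul_div, div_lt_iff₀ (by linarith)]
    nlinarith
  refine ⟨min (1 / 2) δ / q, by positivity, fun t ht t' ht' htt' => ?_⟩
  rw [hQ0 t ht.1, hQ0 t' ht'.1]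
  have hpos : 0 < q * t' := mul_pos hq0 ht'.1
  have hs2 : 0 < 1 / (q * t') := by positivity
  have hpos1 : 0 < q * t := mul_pos hq0 ht.1
  have hs : 1 / (q * t') < 1 / (q * t) := by gcongr
  have hexp : Real.exp (-π * (1 / (q * t'))) ≤ q * t' := by
    have h1 : 1 / (q * t') ≤ Real.exp (π * (1 / (q * t'))) := by
      nlinarith [Real.add_one_le_exp (π * (1 / (q * t'))), Real.pi_gt_three]
    rw [neg_mul, Real.exp_neg]
    simpa using inv_anti₀ hs2 h1
  have hqt : q * t' < min (1 / 2) δ := by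
    have := ht'.2
    rwa [lt_div_iff₀ hq0, mul_comm] at this
  have hy := hexp.trans hqt.le
  have hlt : Real.exp (-π * (1 / (q * t))) < Real.exp (-π * (1 / (q * t'))) := by
    apply Real.exp_lt_exp.2
    nlinarith [Real.pi_pos]
  have hyδ : C * Real.exp (-π * (1 / (q * t'))) * I ≤ δ * (C * I + 1) := by
    nlinarith [mul_le_mul_of_nonneg_right (hy.trans (min_le_right _ _)) hCI]
  have hJlt : J (1 / (q * t')) < J (1 / (q * t)) := by
    have h := hJsub hs2 hs.le (hy.trans (min_le_left _ _))
    nlinarith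
  have hJ0 : 0 ≤ J (1 / (q * t')) := intervalIntegral.integral_nonneg zero_le_one
    fun ξ _ => mul_nonneg (cosKernel_nonneg ξ hs2) (hf0 ξ)
  have hq' : 0 < 1 / q ^ (1 / 2 : ℝ) := by positivity
  exact Real.rpow_lt_rpow (mul_nonneg hq'.le hJ0) (mul_lt_mul_of_pos_left hJlt hq') (by positivity)
end

section
/- Let q > 2, let m, n be coprime integers, let r ∈ (0,1/2), and let μ = δ₀ + rδ_m + rδ_n, so that μ̂(ξ) = 1 + re^{−2πimξ} + re^{−2πinξ}. Then c₁ + c₋₁ = Σ_{k,k'=0}^∞ a_k a_{k'} r^{k+k'} Σ_{(j,j') ∈ Λ_{k,k'}} C(k, j₁) C(k', j₁'), where the double series converges absolutely, a_k = C(q/2, k) is the k-th binomial coefficient in the expansion of (1+x)^{q/2}, and Λ_{k,k'} = {((j₁,j₂),(j₁',j₂')) ∈ (ℕ₀²)² : j₁+j₂ = k, j₁'+j₂' = k', and m(j₁−j₁') + n(j₂−j₂') = ±1}. -/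
open MeasureTheory Real Filter
open scoped FourierTransform ENNReal Topology

/-- The generalized binomial coefficient `C(s,k) = s(s-1)⋯(s-k+1)/k!`. -/
noncomputable def gbinom (s : ℝ) (k : ℕ) : ℝ :=
  (∏ i ∈ Finset.range k, (s - i)) / (Nat.factorial k)

/-- The index set `Λ_{k,k'}` of quadruples `((j₁,j₂),(j₁',j₂'))` with `j₁+j₂ = k`,
`j₁'+j₂' = k'` and `m(j₁-j₁') + n(j₂-j₂') = ±1`. -/
def Lam (m n : ℤ) (k k' : ℕ) : Set ((ℕ × ℕ) × (ℕ × ℕ)) :=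
  { j | j.1.1 + j.1.2 = k ∧ j.2.1 + j.2.2 = k' ∧
      (m * ((j.1.1 : ℤ) - (j.2.1 : ℤ)) + n * ((j.1.2 : ℤ) - (j.2.2 : ℤ)) = 1 ∨
        m * ((j.1.1 : ℤ) - (j.2.1 : ℤ)) + n * ((j.1.2 : ℤ) - (j.2.2 : ℤ)) = -1) }

/-- The inner sum `Σ_{(j,j') ∈ Λ_{k,k'}} C(k,j₁) C(k',j₁')`. -/
noncomputable def lamSum (m n : ℤ) (k k' : ℕ) : ℝ :=
  ∑' j : Lam m n k k', ((k.choose (j : (ℕ × ℕ) × (ℕ × ℕ)).1.1 *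
    k'.choose (j : (ℕ × ℕ) × (ℕ × ℕ)).2.1 : ℕ) : ℝ)

/-- The value of the binomial coefficient as Mathlib's generalized binomial coefficient. -/
theorem gbinom_eq_choose (s : ℝ) (k : ℕ) : gbinom s k = Ring.choose s k := by
  have h : (descPochhammer ℤ k).smeval s = ∏ i ∈ Finset.range k, (s - i) := by
    induction k with
    | zero => simp
    | succ k ih =>
      rw [descPochhammer_succ_right, Polynomial.smeval_mul, ih, Finset.prod_range_succ]
      simp [Polynomial.smeval_natCast]
  rw [gbinom, Ring.choose_eq_smul, h, smul_eq_mul, div_eq_inv_mul]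

theorem hasSum_gbinom_mul_pow (s : ℝ) {z : ℂ} (hz : ‖z‖ < 1) :
    HasSum (fun k : ℕ => (gbinom s k : ℂ) * z ^ k) ((1 + z) ^ (s : ℂ)) := by
  have h := (Complex.one_add_cpow_hasFPowerSeriesOnBall_zero (a := (s : ℂ))).hasSum (y := z)
    (by rw [← ENNReal.ofReal_one, Metric.eball_ofReal]; simpa using hz)
  simpa [-FormalMultilinearSeries.apply_eq_prod_smul_coeff, gbinom_eq_choose,
    Complex.ofReal_choose] using h

theorem summable_abs_gbinom_mul_pow (s : ℝ) {x : ℝ} (hx0 : 0 ≤ x) (hx : x < 1) :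
    Summable (fun k : ℕ => |gbinom s k| * x ^ k) := by
  have h := (hasSum_gbinom_mul_pow s (z := (x : ℂ)) (by simpa [abs_of_nonneg hx0])).summable.norm
  simpa [abs_of_nonneg hx0] using h

/-- The squared modulus of the binomial series, as an absolutely convergent double series. -/
theorem hasSum_norm_one_add_rpow (q : ℝ) {z : ℂ} (hz : ‖z‖ < 1) :
    HasSum (fun kk : ℕ × ℕ => (gbinom (q / 2) kk.1 : ℂ) * z ^ kk.1 *
      ((gbinom (q / 2) kk.2 : ℂ) * (starRingEnd ℂ z) ^ kk.2)) ((‖1 + z‖ ^ q : ℝ) : ℂ) := by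
  have h := hasSum_gbinom_mul_pow (q / 2) hz
  have h' : HasSum (fun k : ℕ => (gbinom (q / 2) k : ℂ) * (starRingEnd ℂ z) ^ k)
      (starRingEnd ℂ ((1 + z) ^ ((q / 2 : ℝ) : ℂ))) := by
    have h0 := h.map (starRingEnd ℂ) Complex.continuous_conj
    simpa only [Function.comp_def, map_mul, map_pow, Complex.conj_ofReal] using h0
  have hs : Summable fun kk : ℕ × ℕ => (gbinom (q / 2) kk.1 : ℂ) * z ^ kk.1 *
      ((gbinom (q / 2) kk.2 : ℂ) * (starRingEnd ℂ z) ^ kk.2) :=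
    summable_mul_of_summable_norm (f := fun k : ℕ => (gbinom (q / 2) k : ℂ) * z ^ k)
      (g := fun k : ℕ => (gbinom (q / 2) k : ℂ) * (starRingEnd ℂ z) ^ k)
      h.summable.norm h'.summable.norm
  have hm := h.mul h' hs
  have hq : (‖1 + z‖ ^ (q / 2)) ^ 2 = ‖1 + z‖ ^ q := by
    rw [← Real.rpow_natCast, ← Real.rpow_mul (norm_nonneg _)]
    norm_num
  rw [Complex.mul_conj, Complex.normSq_eq_norm_sq, Complex.norm_cpow_real, hq] at hm
  exact hm

/-- The character `ξ ↦ e^{-2πilξ}`. -/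
noncomputable def wave (l : ℤ) (ξ : ℝ) : ℂ :=
  Complex.exp (((-2) * π * l * ξ : ℝ) * Complex.I)

theorem wave_add (a b : ℤ) (ξ : ℝ) : wave (a + b) ξ = wave a ξ * wave b ξ := by
  rw [wave, wave, wave, ← Complex.exp_add]
  push_cast
  ring_nf

theorem wave_pow (a : ℤ) (k : ℕ) (ξ : ℝ) : wave a ξ ^ k = wave (a * k) ξ := by
  rw [wave, wave, ← Complex.exp_nat_mul]
  push_cast
  ring_nf

theorem conj_wave (a : ℤ) (ξ : ℝ) : starRingEnd ℂ (wave a ξ) = wave (-a) ξ := by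
  rw [wave, wave, ← Complex.exp_conj, map_mul, Complex.conj_ofReal, Complex.conj_I]
  push_cast
  ring_nf

theorem norm_wave (a : ℤ) (ξ : ℝ) : ‖wave a ξ‖ = 1 := by
  rw [wave, Complex.norm_exp_ofReal_mul_I]

theorem continuous_wave (a : ℤ) : Continuous (wave a) := by
  unfold wave
  fun_prop

theorem integral_wave (l : ℤ) : ∫ ξ in (0 : ℝ)..1, wave l ξ = if l = 0 then 1 else 0 := by
  split_ifs with h
  · simp [wave, h]
  · have hc : ((-2) * π * l * Complex.I : ℂ) ≠ 0 := by
      simp [h, Real.pi_ne_zero]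
    have h1 : ∀ ξ : ℝ, wave l ξ = Complex.exp (((-2) * π * l * Complex.I : ℂ) * ξ) := by
      intro ξ
      rw [wave]
      push_cast
      ring_nf
    have h2 : Complex.exp ((-2) * π * l * Complex.I) = 1 :=
      Complex.exp_eq_one_iff.2 ⟨-l, by push_cast; ring⟩
    simp_rw [h1]
    rw [integral_exp_mul_complex hc, Complex.ofReal_one, mul_one, h2]
    simp

/-- The frequency `m(j₁-j₁') + n(j₂-j₂')` attached to a pair of exponents. -/
def freq (m n : ℤ) (j : (ℕ × ℕ) × (ℕ × ℕ)) : ℤ :=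
  m * ((j.1.1 : ℤ) - (j.2.1 : ℤ)) + n * ((j.1.2 : ℤ) - (j.2.2 : ℤ))

open Finset in
theorem pow_mul_conj_pow_eq_sum_wave (m n p : ℤ) (r : ℝ) (k k' : ℕ) (ξ : ℝ) :
    ((r : ℂ) * (wave m ξ + wave n ξ)) ^ k *
      (starRingEnd ℂ ((r : ℂ) * (wave m ξ + wave n ξ))) ^ k' * wave p ξ =
    (r : ℂ) ^ (k + k') * ∑ j ∈ antidiagonal k ×ˢ antidiagonal k',
      ((k.choose j.1.1 * k'.choose j.2.1 : ℕ) : ℂ) * wave (freq m n j + p) ξ := by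
  rw [map_mul, map_add, conj_wave, conj_wave, Complex.conj_ofReal, mul_pow, mul_pow,
    (Commute.all _ _).add_pow', (Commute.all _ _).add_pow', pow_add]
  rw [mul_mul_mul_comm, sum_mul_sum, ← sum_product', mul_assoc, sum_mul]
  congr 1
  refine sum_congr rfl fun j _ => ?_
  have h : freq m n j + p = m * j.1.1 + n * j.1.2 + (-m * j.2.1 + -n * j.2.2) + p := by
    rw [freq]; ring
  rw [h]
  simp only [wave_add, wave_pow, nsmul_eq_mul]
  push_cast
  ring

open Finset in
theorem integral_pow_mul_conj_pow (m n p : ℤ) (r : ℝ) (k k' : ℕ) :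
    ∫ ξ in (0 : ℝ)..1, ((r : ℂ) * (wave m ξ + wave n ξ)) ^ k *
      (starRingEnd ℂ ((r : ℂ) * (wave m ξ + wave n ξ))) ^ k' * wave p ξ =
    (r : ℂ) ^ (k + k') * ∑ j ∈ antidiagonal k ×ˢ antidiagonal k',
      ((k.choose j.1.1 * k'.choose j.2.1 : ℕ) : ℂ) * if freq m n j + p = 0 then 1 else 0 := by
  simp_rw [pow_mul_conj_pow_eq_sum_wave]
  rw [intervalIntegral.integral_const_mul, intervalIntegral.integral_finsetSum]
  · simp_rw [intervalIntegral.integral_const_mul, integral_wave]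
  · exact fun j _ => ((continuous_wave _).const_mul _).intervalIntegrable _ _

open Finset in
theorem lamSum_eq_sum (m n : ℤ) (k k' : ℕ) :
    (lamSum m n k k' : ℂ) = ∑ j ∈ antidiagonal k ×ˢ antidiagonal k',
      ((k.choose j.1.1 * k'.choose j.2.1 : ℕ) : ℂ) *
        ((if freq m n j + 1 = 0 then 1 else 0) + if freq m n j + -1 = 0 then 1 else 0) := by
  have hL : Lam m n k k' = ((antidiagonal k ×ˢ antidiagonal k').filter
      (fun j => freq m n j = 1 ∨ freq m n j = -1) : Finset ((ℕ × ℕ) × (ℕ × ℕ))) := by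
    ext j
    rw [mem_coe, mem_filter, mem_product, HasAntidiagonal.mem_antidiagonal,
      HasAntidiagonal.mem_antidiagonal, and_assoc]
    rfl
  rw [lamSum, hL, Finset.tsum_subtype' _
    (fun j : (ℕ × ℕ) × (ℕ × ℕ) => ((k.choose j.1.1 * k'.choose j.2.1 : ℕ) : ℝ)), sum_filter,
    Complex.ofReal_sum]
  refine sum_congr rfl fun j _ => ?_
  by_cases h1 : freq m n j = 1
  · simp [h1]
  by_cases h2 : freq m n j = -1
  · simp [h2]
  · have h3 : freq m n j + 1 ≠ 0 := by lia
    have h4 : freq m n j + -1 ≠ 0 := by lia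
    simp [h1, h2, h3, h4]

theorem fourierMeasure_dirac_add (m n : ℤ) {r : ℝ} (hr : 0 ≤ r) (ξ : ℝ) :
    fourierMeasure (Measure.dirac (0 : ℝ) + ENNReal.ofReal r • Measure.dirac ((m : ℝ)) +
      ENNReal.ofReal r • Measure.dirac ((n : ℝ))) ξ =
    1 + (r : ℂ) * wave m ξ + (r : ℂ) * wave n ξ := by
  have hi : ∀ a : ℝ, Integrable
      (fun x : ℝ => Complex.exp (((-2) * π * x * ξ : ℝ) * Complex.I)) (Measure.dirac a) :=
    fun a => integrable_dirac (by simp [enorm_lt_top])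
  have hs : ∀ a : ℝ, Integrable (fun x : ℝ => Complex.exp (((-2) * π * x * ξ : ℝ) * Complex.I))
      (ENNReal.ofReal r • Measure.dirac a) := fun a => (hi a).smul_measure ENNReal.ofReal_ne_top
  rw [fourierMeasure, integral_add_measure ((hi _).add_measure (hs _)) (hs _),
    integral_add_measure (hi _) (hs _), integral_smul_measure, integral_smul_measure]
  simp only [integral_dirac, ENNReal.toReal_ofReal hr, wave, Complex.real_smul]
  simp

/-- The `p`-th Fourier coefficient of `|1 + r(e^{-2πimξ} + e^{-2πinξ})|^q`, as a double series. -/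
theorem hasSum_integral_norm_rpow_mul_wave (q : ℝ) (m n p : ℤ) {r : ℝ} (hr0 : 0 ≤ r)
    (hr : r < 1 / 2) :
    HasSum (fun kk : ℕ × ℕ => (gbinom (q / 2) kk.1 : ℂ) * gbinom (q / 2) kk.2 *
        ∫ ξ in (0 : ℝ)..1, ((r : ℂ) * (wave m ξ + wave n ξ)) ^ kk.1 *
          (starRingEnd ℂ ((r : ℂ) * (wave m ξ + wave n ξ))) ^ kk.2 * wave p ξ)
      (∫ ξ in (0 : ℝ)..1,
        ((‖1 + (r : ℂ) * (wave m ξ + wave n ξ)‖ ^ q : ℝ) : ℂ) * wave p ξ) := by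
  have hz : ∀ ξ, ‖(r : ℂ) * (wave m ξ + wave n ξ)‖ ≤ 2 * r := fun ξ => by
    have h := norm_add_le (wave m ξ) (wave n ξ)
    rw [norm_wave, norm_wave] at h
    rw [norm_mul, Complex.norm_real, Real.norm_of_nonneg hr0]
    nlinarith
  have hb := summable_abs_gbinom_mul_pow (q / 2) (x := 2 * r) (by linarith) (by linarith)
  have hbb : Summable fun kk : ℕ × ℕ =>
      |gbinom (q / 2) kk.1| * (2 * r) ^ kk.1 * (|gbinom (q / 2) kk.2| * (2 * r) ^ kk.2) :=
    summable_mul_of_summable_norm hb.norm hb.norm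
  simp_rw [← intervalIntegral.integral_const_mul]
  have hcont := continuous_wave
  refine intervalIntegral.hasSum_integral_of_dominated_convergence
    (fun kk _ => |gbinom (q / 2) kk.1| * (2 * r) ^ kk.1 *
      (|gbinom (q / 2) kk.2| * (2 * r) ^ kk.2))
    (fun kk => ?_) (fun kk => ae_of_all _ fun ξ _ => ?_) (ae_of_all _ fun ξ _ => hbb)
    intervalIntegrable_const (ae_of_all _ fun ξ _ => ?_)
  · refine Continuous.aestronglyMeasurable ?_
    have hc : Continuous fun ξ => starRingEnd ℂ ((r : ℂ) * (wave m ξ + wave n ξ)) :=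
      Complex.continuous_conj.comp (by fun_prop)
    fun_prop
  · generalize hw : (r : ℂ) * (wave m ξ + wave n ξ) = w
    have hwz : ‖w‖ ≤ 2 * r := hw ▸ hz ξ
    simp only [norm_mul, norm_pow, RCLike.norm_conj, norm_wave, Complex.norm_real,
      Real.norm_eq_abs, mul_one]
    rw [mul_mul_mul_comm |gbinom (q / 2) kk.1| ((2 * r) ^ kk.1)]
    gcongr
  · convert! (hasSum_norm_one_add_rpow q ((hz ξ).trans_lt (by linarith))).mul_right (wave p ξ)
      using 2
    ring

/-- for `μ = δ₀ + rδ_m + rδ_n` with `m, n` coprime and `r ∈ (0,1/2)`, one has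
`μ̂(ξ) = 1 + re^{-2πimξ} + re^{-2πinξ}` and
`c₁ + c₋₁ = Σ_{k,k'} a_k a_{k'} r^{k+k'} Σ_{(j,j') ∈ Λ_{k,k'}} C(k,j₁) C(k',j₁')`,
the double series converging absolutely, where `a_k = C(q/2,k)`. -/
theorem statement6 (q : ℝ) (hq : 2 < q) (m n : ℤ) (hmn : IsCoprime m n)
    (r : ℝ) (hr : r ∈ Set.Ioo (0 : ℝ) (1 / 2))
    (μ : Measure ℝ)
    (hμ : μ = Measure.dirac (0 : ℝ) + ENNReal.ofReal r • Measure.dirac ((m : ℝ)) +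
      ENNReal.ofReal r • Measure.dirac ((n : ℝ))) :
    (∀ ξ : ℝ, fourierMeasure μ ξ =
        1 + (r : ℂ) * Complex.exp (((-2) * π * (m : ℝ) * ξ : ℝ) * Complex.I) +
          (r : ℂ) * Complex.exp (((-2) * π * (n : ℝ) * ξ : ℝ) * Complex.I)) ∧
      Summable (fun kk : ℕ × ℕ =>
        gbinom (q / 2) kk.1 * gbinom (q / 2) kk.2 * r ^ (kk.1 + kk.2) * lamSum m n kk.1 kk.2) ∧
      cCoeff μ q 1 + cCoeff μ q (-1) =
        ((∑' kk : ℕ × ℕ,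
          gbinom (q / 2) kk.1 * gbinom (q / 2) kk.2 * r ^ (kk.1 + kk.2) *
            lamSum m n kk.1 kk.2 : ℝ) : ℂ) := by
  obtain ⟨hr0, hr1⟩ := hr
  have hF : ∀ ξ : ℝ, fourierMeasure μ ξ = 1 + (r : ℂ) * wave m ξ + (r : ℂ) * wave n ξ := by
    rw [hμ]
    exact fourierMeasure_dirac_add m n hr0.le
  have hc : ∀ p : ℤ, cCoeff μ q p = ∫ ξ in (0 : ℝ)..1,
      ((‖1 + (r : ℂ) * (wave m ξ + wave n ξ)‖ ^ q : ℝ) : ℂ) * wave p ξ := fun p => by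
    simp only [cCoeff, hF, mul_add, add_assoc, wave]
  have hsum := (hasSum_integral_norm_rpow_mul_wave q m n 1 hr0.le hr1).add
    (hasSum_integral_norm_rpow_mul_wave q m n (-1) hr0.le hr1)
  rw [← hc, ← hc] at hsum
  have hterm : HasSum (fun kk : ℕ × ℕ => ((gbinom (q / 2) kk.1 * gbinom (q / 2) kk.2 *
      r ^ (kk.1 + kk.2) * lamSum m n kk.1 kk.2 : ℝ) : ℂ)) (cCoeff μ q 1 + cCoeff μ q (-1)) := by
    convert! hsum using 2 with kk
    rw [integral_pow_mul_conj_pow, integral_pow_mul_conj_pow, ← mul_add, ← mul_add,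
      ← Finset.sum_add_distrib]
    simp_rw [← mul_add]
    rw [← lamSum_eq_sum]
    push_cast
    ring
  refine ⟨hF, Complex.summable_ofReal.1 hterm.summable, ?_⟩
  rw [Complex.ofReal_tsum]
  exact hterm.tsum_eq.symm
end

section
/- Let q > 2 not be an even integer, let k(q) be the smallest integer greater than q/2 + 1, let m = 2k(q) + 1 and n = m + 2, and let r ∈ (0,1/2). For the measure μ = δ₀ + rδ_m + rδ_n on ℝ, the Fourier coefficients c_n of |μ̂|^q satisfy c₁ + c₋₁ < 0. Consequently Q_{1,q}(t) = t^{1/(2q)} ‖(H_t ∗ μ)^∧‖_{L^q(ℝ)} is strictly decreasing for all sufficiently small t > 0. -/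
open MeasureTheory Real Filter
open scoped FourierTransform ENNReal Topology

lemma succ_mul_choose_succ (s : ℝ) (a : ℕ) :
    ((a : ℝ) + 1) * Ring.choose s (a + 1) = Ring.choose s a * (s - a) := by
  have h1 := Ring.descPochhammer_eq_factorial_smul_choose s a
  have h2 := Ring.descPochhammer_eq_factorial_smul_choose s (a + 1)
  rw [descPochhammer_succ_right, Polynomial.smeval_mul, h1, Nat.factorial_succ] at h2
  simp only [Polynomial.smeval_sub, Polynomial.smeval_X, Polynomial.smeval_natCast, nsmul_eq_mul,
    Nat.cast_mul, Nat.cast_succ, pow_one, pow_zero, mul_one] at h2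
  have h3 : (a.factorial : ℝ) ≠ 0 := by positivity
  apply mul_left_cancel₀ h3
  linarith

lemma hasSum_choose_mul_pow (s : ℝ) {w : ℂ} (hw : ‖w‖ < 1) :
    HasSum (fun a : ℕ => (Ring.choose s a : ℂ) * w ^ a) ((1 + w) ^ (s : ℂ)) := by
  have h := (Complex.one_add_cpow_hasFPowerSeriesOnBall_zero (a := (s : ℂ))).hasSum
    (y := w) (by simpa [← enorm_eq_nnnorm, ← ofReal_norm] using hw)
  simpa [binomialSeries, Complex.ofReal_choose, mul_comm] using h

lemma summable_abs_choose_mul_pow (s : ℝ) {R : ℝ} (h0 : 0 ≤ R) (h1 : R < 1) :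
    Summable (fun a : ℕ => |Ring.choose s a| * R ^ a) := by
  have h := (hasSum_choose_mul_pow s (w := (R : ℂ))
    (by rwa [Complex.norm_real, Real.norm_of_nonneg h0])).summable.norm
  simpa [abs_of_nonneg h0, ← Complex.ofReal_choose] using h

lemma summable_abs_choose_mul_choose (s : ℝ) {r : ℝ} (h0 : 0 ≤ r) (h1 : r < 1 / 2) :
    Summable (fun p : ℕ × ℕ =>
      |Ring.choose s (p.1 + p.2)| * ((p.1 + p.2).choose p.1 : ℝ) * r ^ (p.1 + p.2)) := by
  rw [← Finset.HasAntidiagonal.sigmaAntidiagonalEquivProd.summable_iff,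
    summable_sigma_of_nonneg (fun _ => by simp only [Function.comp]; positivity)]
  refine ⟨fun _ => (hasSum_fintype _).summable, ?_⟩
  refine (summable_abs_choose_mul_pow s (R := 2 * r) (by linarith) (by linarith)).congr
    fun n => ?_
  rw [tsum_fintype]
  simp only [Function.comp_apply, Finset.HasAntidiagonal.sigmaAntidiagonalEquivProd_apply]
  rw [Finset.sum_coe_sort (Finset.HasAntidiagonal.antidiagonal n) (fun p : ℕ × ℕ =>
      |Ring.choose s (p.1 + p.2)| * ((p.1 + p.2).choose p.1 : ℝ) * r ^ (p.1 + p.2))]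
  have h2 : ((2 : ℝ) * r) ^ n =
      ∑ p ∈ Finset.HasAntidiagonal.antidiagonal n, (n.choose p.1 : ℝ) * r ^ n := by
    rw [two_mul, (Commute.all r r).add_pow']
    refine Finset.sum_congr rfl fun p hp => ?_
    rw [← pow_add, Finset.HasAntidiagonal.mem_antidiagonal.1 hp, nsmul_eq_mul]
  rw [h2, Finset.mul_sum]
  refine Finset.sum_congr rfl fun p hp => ?_
  rw [Finset.HasAntidiagonal.mem_antidiagonal.1 hp, mul_assoc]

lemma hasSum_trinomial (s : ℝ) {r : ℝ} (h0 : 0 ≤ r) (h1 : r < 1 / 2) {x y : ℂ}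
    (hx : ‖x‖ = 1) (hy : ‖y‖ = 1) :
    HasSum (fun p : ℕ × ℕ =>
      ((Ring.choose s (p.1 + p.2) * ((p.1 + p.2).choose p.1 : ℝ) * r ^ (p.1 + p.2) : ℝ) : ℂ) *
        (x ^ p.1 * y ^ p.2)) ((1 + (r * x + r * y)) ^ (s : ℂ)) := by
  have hsum : Summable (fun p : ℕ × ℕ =>
      ((Ring.choose s (p.1 + p.2) * ((p.1 + p.2).choose p.1 : ℝ) * r ^ (p.1 + p.2) : ℝ) : ℂ) *
        (x ^ p.1 * y ^ p.2)) := by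
    refine Summable.of_norm ((summable_abs_choose_mul_choose s h0 h1).congr fun p => ?_)
    simp [hx, hy, abs_of_nonneg h0]
  have hw : ‖(r : ℂ) * x + r * y‖ < 1 := by
    refine (norm_add_le _ _).trans_lt ?_
    simp only [norm_mul, hx, hy, Complex.norm_real, Real.norm_of_nonneg h0]
    linarith
  have h := hasSum_choose_mul_pow s hw
  have hσ := Finset.HasAntidiagonal.sigmaAntidiagonalEquivProd.hasSum_iff.2 hsum.hasSum
  have h2 := hσ.sigma (fun n => hasSum_fintype _)
  convert hsum.hasSum using 1
  refine h.unique ?_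
  convert h2 using 2 with n
  simp only [Function.comp_apply, Finset.HasAntidiagonal.sigmaAntidiagonalEquivProd_apply]
  rw [Finset.sum_coe_sort (Finset.HasAntidiagonal.antidiagonal n) (fun p : ℕ × ℕ =>
      ((Ring.choose s (p.1 + p.2) * ((p.1 + p.2).choose p.1 : ℝ) * r ^ (p.1 + p.2) : ℝ) : ℂ) *
        (x ^ p.1 * y ^ p.2)), (Commute.all _ _).add_pow', Finset.mul_sum]
  refine Finset.sum_congr rfl fun p hp => ?_
  rw [Finset.HasAntidiagonal.mem_antidiagonal.1 hp, nsmul_eq_mul,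
    ← Finset.HasAntidiagonal.mem_antidiagonal.1 hp]
  push_cast
  ring

lemma choose_pos_of_le {s : ℝ} {K : ℕ} (hK : (K : ℝ) < s) : ∀ {a : ℕ}, a ≤ K + 1 →
    0 < Ring.choose s a
  | 0, _ => by simp
  | a + 1, h => by
    have h1 := succ_mul_choose_succ s a
    have h2 := choose_pos_of_le hK (a := a) (by omega)
    have h3 : (a : ℝ) ≤ K := by exact_mod_cast (by omega : a ≤ K)
    have h4 : 0 < Ring.choose s a * (s - a) := mul_pos h2 (by linarith)
    rw [← h1] at h4
    exact pos_of_mul_pos_right h4 (by positivity)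

/-- If `K < s < K + 1`, the generalized binomial coefficients alternate in sign from index
`K + 1` on. -/
lemma neg_one_pow_mul_choose_pos {s : ℝ} {K : ℕ} (hK : (K : ℝ) < s) (hK' : s < K + 1) (i : ℕ) :
    0 < (-1) ^ i * Ring.choose s (K + 1 + i) := by
  induction i with
  | zero => simpa using choose_pos_of_le hK le_rfl
  | succ i ih =>
    have h1 := succ_mul_choose_succ s (K + 1 + i)
    push_cast at h1
    have h4 := mul_pos ih (show (0 : ℝ) < K + 1 + i - s by
      have : (0 : ℝ) ≤ i := by positivity
      linarith)
    have h5 : 0 < ((K : ℝ) + 1 + i + 1) * ((-1) ^ (i + 1) * Ring.choose s (K + 1 + (i + 1))) := by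
      rw [← add_assoc (K + 1), mul_left_comm, h1, pow_succ]
      linarith
    exact pos_of_mul_pos_right h5 (by positivity)

lemma choose_mul_choose_neg {s : ℝ} {K : ℕ} (hK : (K : ℝ) < s) (hK' : s < K + 1) {a b : ℕ}
    (ha : K + 1 ≤ a) (hb : K + 1 ≤ b) (hab : Odd (a + b)) :
    Ring.choose s a * Ring.choose s b < 0 := by
  obtain ⟨i, rfl⟩ := Nat.exists_eq_add_of_le ha
  obtain ⟨j, rfl⟩ := Nat.exists_eq_add_of_le hb
  have h := mul_pos (neg_one_pow_mul_choose_pos hK hK' i) (neg_one_pow_mul_choose_pos hK hK' j)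
  have hij : Odd (i + j) := by
    rw [Nat.odd_iff] at hab ⊢; omega
  have h2 : ((-1 : ℝ)) ^ i * (-1) ^ j = -1 := by rw [← pow_add, hij.neg_one_pow]
  have h3 : (-1) ^ i * Ring.choose s (K + 1 + i) * ((-1) ^ j * Ring.choose s (K + 1 + j))
    = ((-1 : ℝ) ^ i * (-1) ^ j) * (Ring.choose s (K + 1 + i) * Ring.choose s (K + 1 + j)) := by ring
  rw [h3, h2] at h
  linarith

lemma pow_sub_pow_le_two_mul {u v : ℝ} (hu : 0 ≤ u) (huv : u ≤ v) (hv : v ≤ 1 / 2) {k : ℕ}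
    (hk : 2 ≤ k) : v ^ k - u ^ k ≤ 2 * v * (v - u) := by
  induction k, hk using Nat.le_induction with
  | base => nlinarith
  | succ k hk ih =>
    have h1 : u ^ k ≤ v := calc
      u ^ k ≤ u ^ 1 := pow_le_pow_of_le_one hu (by linarith) (by omega)
      _ ≤ v := by simpa
    have h2 := mul_le_mul_of_nonneg_left ih (hu.trans huv)
    have h3 := mul_le_mul_of_nonneg_right h1 (sub_nonneg.2 huv)
    have h4 : 0 ≤ v * (v - u) := mul_nonneg (hu.trans huv) (sub_nonneg.2 huv)
    have h5 := mul_le_mul_of_nonneg_right hv h4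
    rw [pow_succ, pow_succ]
    linarith

/-- A power series in `u` with summable coefficients and negative linear coefficient is
strictly decreasing near zero. -/
lemma exists_strictAntiOn_of_hasSum_neg {ι : Type*} {α : ι → ℝ} (hα : Summable fun i => |α i|)
    (k : ι → ℕ) {γ : ℝ} (hγ : HasSum (fun i => if k i = 1 then α i else 0) γ) (hneg : γ < 0) :
    ∃ δ > 0, StrictAntiOn (fun u : ℝ => ∑' i, α i * u ^ k i) (Set.Ioo 0 δ) := by
  set A := ∑' i, |α i| with hA
  have hA0 : 0 ≤ A := tsum_nonneg fun _ => abs_nonneg _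
  refine ⟨min (1 / 2) (-γ / (2 * A + 1)), lt_min (by norm_num) (by
    apply div_pos <;> linarith), ?_⟩
  intro u hu v hv huv
  have hv1 : v ≤ 1 / 2 := (hv.2.trans_le (min_le_left _ _)).le
  have hv2 : v * (2 * A + 1) < -γ := by
    rw [← lt_div_iff₀ (by linarith)]
    exact hv.2.trans_le (min_le_right _ _)
  have hs : ∀ w : ℝ, 0 ≤ w → w ≤ 1 → Summable fun i => α i * w ^ k i := fun w h0 h1 => by
    refine Summable.of_norm_bounded hα fun i => ?_
    rw [norm_mul, norm_pow, Real.norm_eq_abs, Real.norm_eq_abs, abs_of_nonneg h0]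
    exact mul_le_of_le_one_right (abs_nonneg _) (pow_le_one₀ h0 h1)
  have hd := ((hs v hv.1.le (by linarith)).hasSum.sub
    (hs u hu.1.le (by linarith)).hasSum).sub (hγ.mul_right (v - u))
  have hb : ∀ i, α i * v ^ k i - α i * u ^ k i - (if k i = 1 then α i else 0) * (v - u) ≤
      |α i| * (2 * v * (v - u)) := fun i => by
    have hp : 0 ≤ 2 * v * (v - u) := by
      have := hv.1
      have := sub_pos.2 huv
      positivity
    rcases Nat.lt_or_ge (k i) 2 with h | h
    · have : k i = 0 ∨ k i = 1 := by omega
      rcases this with h | h <;> simp only [h] <;> simp <;> nlinarith [abs_nonneg (α i)]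
    · rw [if_neg (by omega), zero_mul, sub_zero, ← mul_sub]
      refine (le_abs_self _).trans ?_
      rw [abs_mul, abs_of_nonneg (sub_nonneg.2 (pow_le_pow_left₀ hu.1.le huv.le _))]
      exact mul_le_mul_of_nonneg_left (pow_sub_pow_le_two_mul hu.1.le huv.le hv1 h) (abs_nonneg _)
  have hle := hasSum_le hb hd (hα.hasSum.mul_right _)
  have hfin : (v - u) * (v * (2 * A + 1) + γ) < 0 :=
    mul_neg_of_pos_of_neg (sub_pos.2 huv) (by linarith)
  have : 0 ≤ v * (v - u) := mul_nonneg hv.1.le (sub_nonneg.2 huv.le)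
  simp only [← hA] at hle ⊢
  nlinarith

lemma integral_exp_neg_two_pi_mul (n : ℤ) :
    ∫ ξ in (0 : ℝ)..1, Complex.exp (((-2) * π * n * ξ : ℝ) * Complex.I) =
      if n = 0 then 1 else 0 := by
  split_ifs with h
  · simp [h]
  · have hc : ((-2) * π * n : ℂ) * Complex.I ≠ 0 := by
      simp [h, Real.pi_ne_zero]
    have := integral_exp_mul_complex (a := 0) (b := 1) hc
    have h2 : ∀ ξ : ℝ, Complex.exp (((-2) * π * n * ξ : ℝ) * Complex.I) =
      Complex.exp (((-2) * π * n : ℂ) * Complex.I * ξ) := fun ξ => by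
        congr 1; push_cast; ring
    simp_rw [h2, this]
    have h3 : Complex.exp (((-2) * π * n : ℂ) * Complex.I * (1 : ℝ)) = 1 := by
      rw [Complex.exp_eq_one_iff]
      exact ⟨-n, by push_cast; ring⟩
    rw [h3]; simp

/-- Termwise integration of an absolutely convergent trigonometric series over a period. -/
lemma hasSum_fourierCoeff_of_hasSum {ι : Type*} [Countable ι] {α : ι → ℝ}
    (hα : Summable fun i => |α i|) (N : ι → ℤ) {f : ℝ → ℝ}
    (hf : ∀ ξ : ℝ, HasSum
      (fun i => (α i : ℂ) * Complex.exp (((-2) * π * N i * ξ : ℝ) * Complex.I)) (f ξ : ℂ))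
    (n : ℤ) :
    HasSum (fun i => if N i + n = 0 then (α i : ℂ) else 0)
      (∫ ξ in (0 : ℝ)..1, (f ξ : ℂ) * Complex.exp (((-2) * π * n * ξ : ℝ) * Complex.I)) := by
  have h := intervalIntegral.hasSum_integral_of_dominated_convergence (μ := volume) (a := 0)
    (b := 1)
    (F := fun i ξ => (α i : ℂ) * Complex.exp (((-2) * π * N i * ξ : ℝ) * Complex.I) *
      Complex.exp (((-2) * π * n * ξ : ℝ) * Complex.I))
    (f := fun ξ : ℝ => (f ξ : ℂ) * Complex.exp (((-2) * π * n * ξ : ℝ) * Complex.I))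
    (fun i _ => |α i|)
    (fun i => Continuous.aestronglyMeasurable (by fun_prop))
    (fun i => Eventually.of_forall fun ξ _ => by
      simp only [norm_mul, Complex.norm_exp_ofReal_mul_I, Complex.norm_real, Real.norm_eq_abs,
        mul_one, le_refl])
    (Eventually.of_forall fun _ _ => hα)
    (by simp)
    (Eventually.of_forall fun ξ _ => (hf ξ).mul_right _)
  convert! h using 2 with i
  have h2 : ∀ ξ : ℝ, (α i : ℂ) * Complex.exp (((-2) * π * N i * ξ : ℝ) * Complex.I) *
      Complex.exp (((-2) * π * n * ξ : ℝ) * Complex.I) =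
      (α i : ℂ) * Complex.exp (((-2) * π * (N i + n : ℤ) * ξ : ℝ) * Complex.I) := fun ξ => by
    rw [mul_assoc, ← Complex.exp_add]; congr 2; push_cast; ring
  simp_rw [h2, intervalIntegral.integral_const_mul, integral_exp_neg_two_pi_mul]
  split_ifs <;> simp

lemma integral_gaussian_mul_exp {b : ℝ} (hb : 0 < b) (n : ℤ) :
    ∫ ξ : ℝ, (Real.exp (-π * b * ξ ^ 2) : ℂ) *
      Complex.exp (((-2) * π * n * ξ : ℝ) * Complex.I) =
      ((b ^ (-(1 : ℝ) / 2) * Real.exp (-π / b) ^ (n.natAbs ^ 2) : ℝ) : ℂ) := by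
  have h := fourierIntegral_gaussian (b := (π * b : ℂ))
    (by rw [← Complex.ofReal_mul, Complex.ofReal_re]; positivity) (-2 * π * n)
  have hb' : (b : ℂ) ≠ 0 := by exact_mod_cast hb.ne'
  have hpi : (π : ℂ) ≠ 0 := by exact_mod_cast Real.pi_ne_zero
  convert h using 1
  · congr 1; ext ξ
    rw [mul_comm]
    push_cast
    congr 2 <;> ring
  · have h1 : (π : ℂ) / (π * b) = ((b⁻¹ : ℝ) : ℂ) := by push_cast; field_simp
    have h2 : -(-2 * π * n : ℂ) ^ 2 / (4 * (π * b)) = ((n.natAbs ^ 2 : ℕ) * (-π / b) : ℝ) := by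
      have : ((n.natAbs ^ 2 : ℕ) : ℂ) = (n : ℂ) ^ 2 := by
        rw [← Int.cast_natCast, Nat.cast_pow, Int.natAbs_sq, Int.cast_pow]
      rw [Complex.ofReal_mul, Complex.ofReal_natCast, this]; push_cast; field_simp; ring
    rw [h1, h2, show (1 / 2 : ℂ) = ((1 / 2 : ℝ) : ℂ) by push_cast; rfl,
      ← Complex.ofReal_cpow (by positivity), ← Complex.ofReal_exp, ← Complex.ofReal_mul,
      Real.exp_nat_mul, Real.inv_rpow hb.le, ← Real.rpow_neg hb.le]
    norm_num

/-- Termwise integration of an absolutely convergent trigonometric series against a Gaussian. -/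
lemma hasSum_gaussian_of_hasSum {ι : Type*} [Countable ι] {α : ι → ℝ}
    (hα : Summable fun i => |α i|) (N : ι → ℤ) {f : ℝ → ℝ}
    (hf : ∀ ξ : ℝ, HasSum
      (fun i => (α i : ℂ) * Complex.exp (((-2) * π * N i * ξ : ℝ) * Complex.I)) (f ξ : ℂ))
    {b : ℝ} (hb : 0 < b) :
    HasSum (fun i => b ^ (-(1 : ℝ) / 2) * (α i * Real.exp (-π / b) ^ ((N i).natAbs ^ 2)))
      (∫ ξ, Real.exp (-π * b * ξ ^ 2) * f ξ) := by
  have hg : Integrable fun ξ : ℝ => Real.exp (-π * b * ξ ^ 2) := by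
    simpa using integrable_exp_neg_mul_sq (b := π * b) (by positivity)
  have h := MeasureTheory.hasSum_integral_of_dominated_convergence (μ := volume)
    (F := fun i (ξ : ℝ) => (Real.exp (-π * b * ξ ^ 2) : ℂ) *
      ((α i : ℂ) * Complex.exp (((-2) * π * N i * ξ : ℝ) * Complex.I)))
    (f := fun ξ : ℝ => (Real.exp (-π * b * ξ ^ 2) : ℂ) * (f ξ : ℂ))
    (fun i ξ => Real.exp (-π * b * ξ ^ 2) * |α i|)
    (fun i => Continuous.aestronglyMeasurable (by fun_prop))
    (fun i => Eventually.of_forall fun ξ => by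
      simp only [norm_mul, Complex.norm_exp_ofReal_mul_I, Complex.norm_real, Real.norm_eq_abs,
        mul_one, Real.abs_exp, le_refl])
    (Eventually.of_forall fun _ => hα.mul_left _)
    (by simp_rw [tsum_mul_left]; exact hg.mul_const _)
    (Eventually.of_forall fun ξ => (hf ξ).mul_left _)
  have h3 : ∫ ξ : ℝ, (Real.exp (-π * b * ξ ^ 2) : ℂ) * (f ξ : ℂ) =
      ((∫ ξ, Real.exp (-π * b * ξ ^ 2) * f ξ : ℝ) : ℂ) := by
    rw [← integral_complex_ofReal]
    simp_rw [Complex.ofReal_mul]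
  rw [h3] at h
  rw [← Complex.hasSum_ofReal]
  convert! h using 2 with i
  have h2 : ∀ ξ : ℝ, (Real.exp (-π * b * ξ ^ 2) : ℂ) *
    ((α i : ℂ) * Complex.exp (((-2) * π * N i * ξ : ℝ) * Complex.I)) =
    (α i : ℂ) * ((Real.exp (-π * b * ξ ^ 2) : ℂ) *
      Complex.exp (((-2) * π * N i * ξ : ℝ) * Complex.I)) := fun ξ => by ring
  simp_rw [h2, integral_const_mul, integral_gaussian_mul_exp hb]
  push_cast; ring

/-- The coefficients of the trigonometric expansion of `|1 + r x + r y|^q`, `s = q / 2`. -/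
noncomputable def trigCoeff (s r : ℝ) (p : ℕ × ℕ) : ℝ :=
  Ring.choose s (p.1 + p.2) * ((p.1 + p.2).choose p.1 : ℝ) * r ^ (p.1 + p.2)

/-- The frequencies of the trigonometric expansion of `|1 + r x + r y|^q`. -/
def trigFreq (m n : ℤ) (i : (ℕ × ℕ) × (ℕ × ℕ)) : ℤ :=
  (m * i.1.1 + n * i.1.2) - (m * i.2.1 + n * i.2.2)

lemma summable_abs_trigCoeff_mul (s : ℝ) {r : ℝ} (h0 : 0 ≤ r) (h1 : r < 1 / 2) :
    Summable fun i : (ℕ × ℕ) × (ℕ × ℕ) => |trigCoeff s r i.1 * trigCoeff s r i.2| := by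
  have h : Summable fun p : ℕ × ℕ => ‖trigCoeff s r p‖ :=
    (summable_abs_choose_mul_choose s h0 h1).congr fun p => by
      simp [trigCoeff, abs_of_nonneg h0]
  exact h.mul_norm h

lemma hasSum_mul_of_complex {ι ι' : Type*} {g : ι → ℂ} {g' : ι' → ℂ} {z z' : ℂ}
    (h : HasSum g z) (h' : HasSum g' z') :
    HasSum (fun i : ι × ι' => g i.1 * g' i.2) (z * z') :=
  h.mul h' (summable_mul_of_summable_norm (summable_norm_iff.2 h.summable)
    (summable_norm_iff.2 h'.summable))

lemma hasSum_mul_conj_self {ι : Type*} {g : ι → ℂ} {z : ℂ} (h : HasSum g z) :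
    HasSum (fun i : ι × ι => g i.1 * (starRingEnd ℂ) (g i.2)) (z * (starRingEnd ℂ) z) :=
  hasSum_mul_of_complex (g' := fun i => (starRingEnd ℂ) (g i)) (z' := (starRingEnd ℂ) z) h
    (h.map (starRingEnd ℂ) Complex.continuous_conj)

lemma hasSum_norm_rpow (q : ℝ) {r : ℝ} (h0 : 0 ≤ r) (h1 : r < 1 / 2) (m n : ℤ) (ξ : ℝ) :
    HasSum (fun i : (ℕ × ℕ) × (ℕ × ℕ) =>
      ((trigCoeff (q / 2) r i.1 * trigCoeff (q / 2) r i.2 : ℝ) : ℂ) *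
        Complex.exp (((-2) * π * trigFreq m n i * ξ : ℝ) * Complex.I))
      ((‖1 + (r * Complex.exp (((-2) * π * m * ξ : ℝ) * Complex.I) +
        r * Complex.exp (((-2) * π * n * ξ : ℝ) * Complex.I))‖ ^ q : ℝ) : ℂ) := by
  have h := hasSum_trinomial (q / 2) h0 h1
    (Complex.norm_exp_ofReal_mul_I ((-2) * π * m * ξ))
    (Complex.norm_exp_ofReal_mul_I ((-2) * π * n * ξ))
  have hval : ∀ z : ℂ, ((‖z‖ ^ q : ℝ) : ℂ) = z ^ ((q / 2 : ℝ) : ℂ) *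
      (starRingEnd ℂ) (z ^ ((q / 2 : ℝ) : ℂ)) := fun z => by
    rw [Complex.mul_conj, Complex.normSq_eq_norm_sq, Complex.norm_cpow_real,
      ← Real.rpow_natCast, ← Real.rpow_mul (norm_nonneg _)]
    congr 2
    push_cast
    ring
  rw [hval]
  convert! hasSum_mul_conj_self h using 2 with i
  simp only [map_mul, map_natCast, Complex.conj_ofReal, ← Complex.exp_conj, Complex.conj_I,
    ← Complex.exp_nat_mul]
  rw [← Complex.exp_add, ← Complex.exp_add, mul_mul_mul_comm, ← Complex.exp_add,
    ← Complex.ofReal_mul]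
  simp only [trigFreq, trigCoeff]
  congr 2
  push_cast
  ring

lemma trigFreq_natAbs_eq_one {K : ℕ} {i : (ℕ × ℕ) × (ℕ × ℕ)}
    (hi : (trigFreq (2 * K + 1) (2 * K + 3) i).natAbs = 1) :
    K ≤ i.1.1 + i.1.2 ∧ K ≤ i.2.1 + i.2.2 ∧ Odd ((i.1.1 + i.1.2) + (i.2.1 + i.2.2)) := by
  obtain ⟨⟨j, l⟩, ⟨j', l'⟩⟩ := i
  simp only [trigFreq] at hi ⊢
  set d : ℤ := (j + l) - (j' + l') with hd
  have hE : ((2 * (K : ℤ) + 1) * j + (2 * K + 3) * l) - ((2 * K + 1) * j' + (2 * K + 3) * l') =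
      2 * ((K + 1) * d) + ((l - l') - (j - j')) := by rw [hd]; ring
  rw [hE] at hi
  have hodd : Odd ((j + l) + (j' + l')) := by
    rw [Nat.odd_iff]; omega
  have hd0 : d ≠ 0 := by
    rw [Nat.odd_iff] at hodd; omega
  refine ⟨?_, ?_, hodd⟩
  · rcases lt_or_gt_of_ne hd0 with h | h
    · have : (K + 1) * d ≤ K * (-1) + d := by nlinarith
      omega
    · have : K * 1 + d ≤ (K + 1) * d := by nlinarith
      omega
  · rcases lt_or_gt_of_ne hd0 with h | h
    · have : (K + 1) * d ≤ K * (-1) + d := by nlinarith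
      omega
    · have : K * 1 + d ≤ (K + 1) * d := by nlinarith
      omega

/-- The total mass of the frequencies `±1` is negative. -/
lemma hasSum_trigCoeff_neg {s r : ℝ} (h0 : 0 < r) (h1 : r < 1 / 2) {K : ℕ} (hK : (K : ℝ) < s)
    (hK' : s < K + 1) :
    ∃ γ < 0, HasSum (fun i : (ℕ × ℕ) × (ℕ × ℕ) =>
      if (trigFreq (2 * (K + 2 : ℕ) + 1) (2 * (K + 2 : ℕ) + 3) i).natAbs ^ 2 = 1 then
        trigCoeff s r i.1 * trigCoeff s r i.2 else 0) γ := by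
  have hs : Summable (fun i : (ℕ × ℕ) × (ℕ × ℕ) =>
      if (trigFreq (2 * (K + 2 : ℕ) + 1) (2 * (K + 2 : ℕ) + 3) i).natAbs ^ 2 = 1 then
        trigCoeff s r i.1 * trigCoeff s r i.2 else 0) := by
    refine Summable.of_norm_bounded (summable_abs_trigCoeff_mul s h0.le h1) fun i => ?_
    split_ifs
    · exact le_rfl
    · rw [norm_zero]; exact abs_nonneg _
  have hneg : ∀ i : (ℕ × ℕ) × (ℕ × ℕ),
      (trigFreq (2 * (K + 2 : ℕ) + 1) (2 * (K + 2 : ℕ) + 3) i).natAbs ^ 2 = 1 →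
        trigCoeff s r i.1 * trigCoeff s r i.2 < 0 := fun i hi => by
    obtain ⟨ha, hb, hab⟩ := trigFreq_natAbs_eq_one (K := K + 2) (i := i)
      (by simpa using hi)
    have hc := choose_mul_choose_neg hK hK' (by omega) (by omega) hab
    have e : trigCoeff s r i.1 * trigCoeff s r i.2 =
        Ring.choose s (i.1.1 + i.1.2) * Ring.choose s (i.2.1 + i.2.2) *
        (((i.1.1 + i.1.2).choose i.1.1 * (i.2.1 + i.2.2).choose i.2.1 : ℕ) *
          (r ^ (i.1.1 + i.1.2) * r ^ (i.2.1 + i.2.2))) := by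
      simp only [trigCoeff]; push_cast; ring
    rw [e]
    refine mul_neg_of_neg_of_pos hc (mul_pos ?_ (by positivity))
    exact_mod_cast Nat.mul_pos (Nat.choose_pos (Nat.le_add_right _ _))
      (Nat.choose_pos (Nat.le_add_right _ _))
  refine ⟨_, ?_, hs.hasSum⟩
  have hi : (trigFreq (2 * (K + 2 : ℕ) + 1) (2 * (K + 2 : ℕ) + 3)
      ((K + 3, 0), (0, K + 2))).natAbs ^ 2 = 1 := by
    have : trigFreq (2 * (K + 2 : ℕ) + 1) (2 * (K + 2 : ℕ) + 3) ((K + 3, 0), (0, K + 2)) = 1 := by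
      simp only [trigFreq]; push_cast; ring
    rw [this]; rfl
  have hle : ∀ i : (ℕ × ℕ) × (ℕ × ℕ),
      (if (trigFreq (2 * (K + 2 : ℕ) + 1) (2 * (K + 2 : ℕ) + 3) i).natAbs ^ 2 = 1 then
        trigCoeff s r i.1 * trigCoeff s r i.2 else 0) ≤ 0 := fun i => by
    split_ifs with h
    · exact (hneg i h).le
    · exact le_rfl
  have := hs.tsum_lt_tsum hle (i := ((K + 3, 0), (0, K + 2)))
    (by rw [if_pos hi]; exact hneg _ hi) summable_zero
  simpa using this

lemma integral_three_dirac {E : Type*} [NormedAddCommGroup E] [NormedSpace ℝ E] [CompleteSpace E]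
    {r : ℝ} (hr : 0 ≤ r) (a b : ℝ) (g : ℝ → E) :
    ∫ x, g x ∂(Measure.dirac (0 : ℝ) + ENNReal.ofReal r • Measure.dirac a +
      ENNReal.ofReal r • Measure.dirac b) = g 0 + (r • g a + r • g b) := by
  have hi : ∀ c : ℝ, Integrable g (Measure.dirac c) := fun c => integrable_dirac (by simp)
  rw [integral_add_measure ((hi _).add_measure ((hi _).smul_measure ENNReal.ofReal_ne_top))
      ((hi _).smul_measure ENNReal.ofReal_ne_top),
    integral_add_measure (hi _) ((hi _).smul_measure ENNReal.ofReal_ne_top),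
    integral_smul_measure, integral_smul_measure]
  simp [ENNReal.toReal_ofReal hr, add_assoc]

lemma fourierMeasure_three_dirac {r : ℝ} (hr : 0 ≤ r) (a b ξ : ℝ) :
    fourierMeasure (Measure.dirac (0 : ℝ) + ENNReal.ofReal r • Measure.dirac a +
      ENNReal.ofReal r • Measure.dirac b) ξ =
      1 + (r * Complex.exp (((-2) * π * a * ξ : ℝ) * Complex.I) +
        r * Complex.exp (((-2) * π * b * ξ : ℝ) * Complex.I)) := by
  rw [fourierMeasure, integral_three_dirac hr]
  simp

lemma exp_mul_heatKernel1_eq {t : ℝ} (ht : 0 < t) (a ξ x : ℝ) :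
    Complex.exp (((-2) * π * x * ξ : ℝ) * Complex.I) * (heatKernel1 t (x - a) : ℂ) =
      ((t ^ (-(1 : ℝ) / 2) : ℝ) : ℂ) * Complex.exp (((-π / t : ℝ) : ℂ) * x ^ 2 +
        (2 * π * a / t - 2 * π * ξ * Complex.I) * x + (-π * a ^ 2 / t)) := by
  have ht' : (t : ℂ) ≠ 0 := by exact_mod_cast ht.ne'
  rw [heatKernel1, Complex.ofReal_mul (t ^ _), mul_left_comm, Complex.ofReal_exp, ← Complex.exp_add]
  congr 2
  push_cast
  field_simp
  ring

lemma integrable_exp_mul_heatKernel1 {t : ℝ} (ht : 0 < t) (a ξ : ℝ) :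
    Integrable fun x : ℝ =>
      Complex.exp (((-2) * π * x * ξ : ℝ) * Complex.I) * (heatKernel1 t (x - a) : ℂ) := by
  simp_rw [exp_mul_heatKernel1_eq ht]
  refine (integrable_cexp_quadratic' ?_ _ _).const_mul _
  rw [Complex.ofReal_re, neg_div]
  exact neg_neg_of_pos (by positivity)

/-- The Fourier transform of a translated heat kernel. -/
lemma integral_exp_mul_heatKernel1 {t : ℝ} (ht : 0 < t) (a ξ : ℝ) :
    ∫ x : ℝ, Complex.exp (((-2) * π * x * ξ : ℝ) * Complex.I) * (heatKernel1 t (x - a) : ℂ) =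
      (Real.exp (-π * t * ξ ^ 2) : ℂ) * Complex.exp (((-2) * π * a * ξ : ℝ) * Complex.I) := by
  have ht' : (t : ℂ) ≠ 0 := by exact_mod_cast ht.ne'
  have hpi : (π : ℂ) ≠ 0 := by exact_mod_cast Real.pi_ne_zero
  simp_rw [exp_mul_heatKernel1_eq ht]
  rw [integral_const_mul, integral_cexp_quadratic (by
    rw [Complex.ofReal_re, neg_div]
    exact neg_neg_of_pos (by positivity))]
  have h1 : (π : ℂ) / -((-π / t : ℝ) : ℂ) = (t : ℂ) := by push_cast; field_simp
  rw [h1, show (1 / 2 : ℂ) = ((1 / 2 : ℝ) : ℂ) by push_cast; rfl,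
    ← Complex.ofReal_cpow ht.le, ← mul_assoc, ← Complex.ofReal_mul, ← Real.rpow_add ht,
    Complex.ofReal_exp, ← Complex.exp_add]
  norm_num
  congr 1
  field_simp
  ring_nf
  rw [Complex.I_sq]
  ring

lemma fourier_heatKernel1_conv {r : ℝ} (hr : 0 ≤ r) (a b : ℝ) {t : ℝ} (ht : 0 < t) (ξ : ℝ)
    {μ : Measure ℝ} (hμ : μ = Measure.dirac (0 : ℝ) + ENNReal.ofReal r • Measure.dirac a +
      ENNReal.ofReal r • Measure.dirac b) :
    (𝓕 fun x => (((∫ y, heatKernel1 t (x - y) ∂μ) : ℝ) : ℂ)) ξ =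
      (Real.exp (-π * t * ξ ^ 2) : ℂ) * fourierMeasure μ ξ := by
  rw [hμ, fourierMeasure_three_dirac hr, Real.fourier_real_eq_integral_exp_smul]
  simp_rw [integral_three_dirac hr]
  have h := fun c => integrable_exp_mul_heatKernel1 ht c ξ
  have e : ∀ x : ℝ, Complex.exp (((-2) * π * x * ξ : ℝ) * Complex.I) •
      ((heatKernel1 t (x - 0) + (r • heatKernel1 t (x - a) + r • heatKernel1 t (x - b)) : ℝ) : ℂ) =
      Complex.exp (((-2) * π * x * ξ : ℝ) * Complex.I) * (heatKernel1 t (x - 0) : ℂ) +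
      (r * (Complex.exp (((-2) * π * x * ξ : ℝ) * Complex.I) * (heatKernel1 t (x - a) : ℂ)) +
      r * (Complex.exp (((-2) * π * x * ξ : ℝ) * Complex.I) * (heatKernel1 t (x - b) : ℂ))) :=
    fun x => by simp only [smul_eq_mul]; push_cast; ring
  simp_rw [e]
  rw [integral_add (h 0) ?_, integral_add ((h a).const_mul _) ((h b).const_mul _),
    integral_const_mul, integral_const_mul]
  · simp_rw [integral_exp_mul_heatKernel1 ht]
    simp
    ring
  · exact ((h a).const_mul _).add ((h b).const_mul _)

lemma hasSum_norm_fourierMeasure_rpow (q : ℝ) {r : ℝ} (h0 : 0 ≤ r) (h1 : r < 1 / 2) (m n : ℤ)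
    (ξ : ℝ) {μ : Measure ℝ} (hμ : μ = Measure.dirac (0 : ℝ) +
      ENNReal.ofReal r • Measure.dirac (m : ℝ) + ENNReal.ofReal r • Measure.dirac (n : ℝ)) :
    HasSum (fun i : (ℕ × ℕ) × (ℕ × ℕ) =>
      ((trigCoeff (q / 2) r i.1 * trigCoeff (q / 2) r i.2 : ℝ) : ℂ) *
        Complex.exp (((-2) * π * trigFreq m n i * ξ : ℝ) * Complex.I))
      ((‖fourierMeasure μ ξ‖ ^ q : ℝ) : ℂ) := by
  rw [hμ, fourierMeasure_three_dirac h0]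
  exact hasSum_norm_rpow q h0 h1 m n ξ

/-- `Q_{1,q}` as a power of a Gaussian integral. -/
lemma Q1_eq_integral {q : ℝ} (hq : 0 < q) {r : ℝ} (hr : 0 ≤ r) (a b : ℝ) {t : ℝ} (ht : 0 < t)
    {μ : Measure ℝ} (hμ : μ = Measure.dirac (0 : ℝ) + ENNReal.ofReal r • Measure.dirac a +
      ENNReal.ofReal r • Measure.dirac b) :
    Q1 μ q t = (t ^ (1 / 2 : ℝ) *
      ∫ ξ : ℝ, Real.exp (-π * (q * t) * ξ ^ 2) * ‖fourierMeasure μ ξ‖ ^ q) ^ q⁻¹ := by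
  have hF : (𝓕 fun x => (((∫ y, heatKernel1 t (x - y) ∂μ) : ℝ) : ℂ)) =
      fun ξ => (Real.exp (-π * t * ξ ^ 2) : ℂ) * fourierMeasure μ ξ :=
    funext fun ξ => fourier_heatKernel1_conv hr a b ht ξ hμ
  have hc : Continuous fun ξ => (Real.exp (-π * t * ξ ^ 2) : ℂ) * fourierMeasure μ ξ := by
    rw [hμ]
    simp_rw [fourierMeasure_three_dirac hr]
    fun_prop
  have hnorm : ∀ ξ : ℝ, ‖(Real.exp (-π * t * ξ ^ 2) : ℂ) * fourierMeasure μ ξ‖ ^ q =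
      Real.exp (-π * (q * t) * ξ ^ 2) * ‖fourierMeasure μ ξ‖ ^ q := fun ξ => by
    rw [norm_mul, Real.mul_rpow (norm_nonneg _) (norm_nonneg _), Complex.norm_real,
      Real.norm_of_nonneg (Real.exp_pos _).le, ← Real.exp_mul]
    congr 2
    ring
  rw [Q1, hF, toReal_eLpNorm hc.aestronglyMeasurable,
    lpNorm_eq_integral_norm_rpow_toReal (by simpa using hq) ENNReal.ofReal_ne_top
      hc.aestronglyMeasurable, ENNReal.toReal_ofReal hq.le,
    Real.mul_rpow (by positivity) (integral_nonneg fun ξ => by positivity), ← Real.rpow_mul ht.le]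
  simp_rw [hnorm]
  congr 2
  field_simp

/-- let `q > 2` not be an even integer, `k(q)` the smallest integer greater than
`q/2 + 1`, `m = 2k(q)+1`, `n = m+2`, `r ∈ (0,1/2)` and `μ = δ₀ + rδ_m + rδ_n`. Then
`c₁ + c₋₁ < 0`, and consequently `Q_{1,q}` is strictly decreasing for small `t > 0`. -/
theorem statement13 (q : ℝ) (hq : 2 < q) (hqodd : ∀ j : ℕ, q ≠ 2 * j)
    (kq : ℤ) (hkq₁ : q / 2 + 1 < (kq : ℝ)) (hkq₂ : ∀ j : ℤ, q / 2 + 1 < (j : ℝ) → kq ≤ j)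
    (r : ℝ) (hr : r ∈ Set.Ioo (0 : ℝ) (1 / 2)) (μ : Measure ℝ)
    (hμ : μ = Measure.dirac (0 : ℝ) +
      ENNReal.ofReal r • Measure.dirac ((2 * kq + 1 : ℤ) : ℝ) +
      ENNReal.ofReal r • Measure.dirac ((2 * kq + 1 + 2 : ℤ) : ℝ)) :
    (∃ γ : ℝ, γ < 0 ∧ cCoeff μ q 1 + cCoeff μ q (-1) = (γ : ℂ)) ∧
      ∃ t₀ > 0, StrictAntiOn (Q1 μ q) (Set.Ioo 0 t₀) := by
  obtain ⟨K, rfl⟩ : ∃ K : ℕ, kq = (K + 2 : ℕ) := by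
    have : (2 : ℝ) < kq := by linarith
    have : (2 : ℤ) < kq := by exact_mod_cast this
    exact ⟨(kq - 2).toNat, by omega⟩
  have hK' : q / 2 < K + 1 := by push_cast at hkq₁; linarith
  have hK : (K : ℝ) < q / 2 := by
    by_contra! h
    rcases h.lt_or_eq with h | h
    · have := hkq₂ (K + 1) (by push_cast; linarith)
      push_cast at this
      omega
    · exact hqodd K (by linarith)
  obtain ⟨h0, h1⟩ := hr
  have hα := summable_abs_trigCoeff_mul (q / 2) h0.le h1
  have hq0 : 0 < q := by linarith
  rw [show (2 * ((K + 2 : ℕ) : ℤ) + 1 + 2 : ℤ) = 2 * ((K + 2 : ℕ) : ℤ) + 3 by ring] at hμ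
  have hf := fun ξ => hasSum_norm_fourierMeasure_rpow q h0.le h1 _ _ ξ hμ
  obtain ⟨γ, hγ, hsum⟩ := hasSum_trigCoeff_neg h0 h1 hK hK'
  refine ⟨⟨γ, hγ, ?_⟩, ?_⟩
  · have hc := (hasSum_fourierCoeff_of_hasSum hα _ hf 1).add
      (hasSum_fourierCoeff_of_hasSum hα _ hf (-1))
    refine hc.unique ?_
    convert! Complex.hasSum_ofReal.2 hsum using 2 with i
    generalize trigFreq _ _ i = N
    generalize trigCoeff (q / 2) r i.1 * trigCoeff (q / 2) r i.2 = c
    have : N.natAbs ^ 2 = 1 ↔ N + 1 = 0 ∨ N + -1 = 0 := by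
      rw [Nat.pow_eq_one]; omega
    simp only [this]
    by_cases h : N + 1 = 0
    · rw [if_pos h, if_neg (by omega), if_pos (Or.inl h), add_zero]
    · rw [if_neg h, zero_add]
      simp only [h, false_or]
      split_ifs <;> simp
  · obtain ⟨δ, hδ, hanti⟩ := exists_strictAntiOn_of_hasSum_neg hα _ hsum hγ
    have hlim : Tendsto (fun t : ℝ => Real.exp (-π / (q * t))) (𝓝[>] 0) (𝓝 0) := by
      refine Real.tendsto_exp_atBot.comp ?_
      have : Tendsto (fun t : ℝ => (-π / q) * t⁻¹) (𝓝[>] 0) atBot :=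
        tendsto_inv_nhdsGT_zero.const_mul_atTop_of_neg
          (by rw [neg_div]; exact neg_neg_of_pos (by positivity))
      exact this.congr fun t => by rw [div_mul_eq_div_div, div_eq_mul_inv _ t]
    obtain ⟨t₀, ht₀, hlt⟩ := mem_nhdsGT_iff_exists_Ioo_subset.1 (hlim.eventually_lt_const hδ)
    refine ⟨t₀, ht₀, fun t ht t' ht' htt' => ?_⟩
    set F := fun u : ℝ => ∑' i : (ℕ × ℕ) × (ℕ × ℕ),
      trigCoeff (q / 2) r i.1 * trigCoeff (q / 2) r i.2 *
        u ^ (trigFreq (2 * (K + 2 : ℕ) + 1) (2 * (K + 2 : ℕ) + 3) i).natAbs ^ 2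
    have hI : ∀ u : ℝ, 0 < u → u ^ (1 / 2 : ℝ) *
        ∫ ξ : ℝ, Real.exp (-π * (q * u) * ξ ^ 2) * ‖fourierMeasure μ ξ‖ ^ q =
        q ^ (-(1 : ℝ) / 2) * F (Real.exp (-π / (q * u))) := fun u hu => by
      rw [← (hasSum_gaussian_of_hasSum hα _ hf (mul_pos hq0 hu)).tsum_eq, tsum_mul_left,
        Real.mul_rpow hq0.le hu.le, mul_left_comm, mul_assoc, ← mul_assoc (u ^ (-(1 : ℝ) / 2)),
        ← Real.rpow_add hu, ← add_div, neg_add_cancel, zero_div, Real.rpow_zero, one_mul]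
    have ht₁ : 0 < t := ht.1
    have ht₁' : 0 < t' := ht'.1
    rw [Q1_eq_integral hq0 h0.le _ _ ht₁ hμ, Q1_eq_integral hq0 h0.le _ _ ht₁' hμ]
    refine Real.rpow_lt_rpow
      (mul_nonneg (by positivity) (integral_nonneg fun ξ => by positivity)) ?_ (by positivity)
    rw [hI t ht₁, hI t' ht₁']
    refine mul_lt_mul_of_pos_left (hanti ⟨Real.exp_pos _, hlt ht⟩ ⟨Real.exp_pos _, hlt ht'⟩ ?_)
      (by positivity)
    rw [Real.exp_lt_exp, neg_div, neg_div, neg_lt_neg_iff]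
    gcongr
end
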